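/- arXiv:2004.08802 — 2 statements merged into one kernel-verified Lean document; each statement's English description precedes it below -/
import Mathlib

section
/- Assume N ≥ 4 and p = 1 + 4/(N−3). For every a ∈ ℝ there exists a unique C² solution U(·,a) of (PDE) defined in a neighborhood of ρ = 1 such that U(1,a) = b₀ and U′(1,a) = a. Furthermore U″(1,a) = −(N−1)a/2, and U(·,a) extends to a C² solution of (PDE) on (0,1]. -/
open Set Filter

noncomputable def alphaP (p : ℝ) : ℝ := 2 / (p - 1)

noncomputable def b0 (p : ℝ) : ℝ := (2 * (p + 1) / (p - 1) ^ 2) ^ ((1 : ℝ) / (p - 1))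

noncomputable def bInf (N : ℕ) (p : ℝ) : ℝ :=
  (alphaP p * ((N : ℝ) - 2 - alphaP p)) ^ (alphaP p / 2)

noncomputable def uInf (N : ℕ) (p : ℝ) (ρ : ℝ) : ℝ := bInf N p * ρ ^ (-(alphaP p))

/-- `u` solves `(1-ρ²)u'' + ((N-1)/ρ - 2(α+1)ρ)u' - α(α+1)u + |u|^{p-1}u = 0` on `s`. -/
def IsSolOn (N : ℕ) (p : ℝ) (u : ℝ → ℝ) (s : Set ℝ) : Prop :=
  ∀ ρ ∈ s,
    (1 - ρ ^ 2) * deriv (deriv u) ρ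
      + (((N : ℝ) - 1) / ρ - 2 * (alphaP p + 1) * ρ) * deriv u ρ
      - alphaP p * (alphaP p + 1) * u ρ + |u ρ| ^ (p - 1) * u ρ = 0

lemma abs_integral_le_of_exp_bound {lam D r : ℝ} (hlam : 0 < lam) (hD : 0 ≤ D) {z : ℝ → ℝ}
    (h : ∀ t ∈ uIcc 0 r, t ≠ 0 → |z t| ≤ D * Real.exp (lam * |t|)) :
    |∫ t in (0 : ℝ)..r, z t| ≤ D / lam * Real.exp (lam * |r|) := by
  have key : ∀ (R : ℝ) (y : ℝ → ℝ), 0 ≤ R →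
      (∀ t ∈ Ioc 0 R, |y t| ≤ D * Real.exp (lam * t)) →
      |∫ t in (0 : ℝ)..R, y t| ≤ D / lam * Real.exp (lam * R) := by
    intro R y hR hy
    have hint : ∫ t in (0 : ℝ)..R, D * Real.exp (lam * t)
        = D / lam * Real.exp (lam * R) - D / lam * Real.exp (lam * 0) := by
      refine intervalIntegral.integral_eq_sub_of_hasDerivAt
        (f := fun t => D / lam * Real.exp (lam * t)) (fun t _ => ?_)
        (Continuous.intervalIntegrable (by fun_prop) _ _)
      have := (((hasDerivAt_id t).const_mul lam).exp).const_mul (D / lam)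
      refine this.congr_deriv ?_
      simp only [id]
      field_simp
    have h1 := intervalIntegral.norm_integral_le_of_norm_le (μ := MeasureTheory.volume) (f := y)
      (g := fun t => D * Real.exp (lam * t)) hR
      (Eventually.of_forall fun t ht => hy t ht)
      (Continuous.intervalIntegrable (by fun_prop) _ _)
    rw [hint, Real.norm_eq_abs] at h1
    have : 0 ≤ D / lam * Real.exp (lam * 0) := by positivity
    linarith
  rcases le_total 0 r with hr | hr
  · rw [abs_of_nonneg hr]
    refine key r z hr fun t ht => ?_
    have := h t (by rw [uIcc_of_le hr]; exact ⟨ht.1.le, ht.2⟩) ht.1.ne'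
    rwa [abs_of_pos ht.1] at this
  · rw [abs_of_nonpos hr]
    have hsub : ∫ t in (0 : ℝ)..r, z t = -∫ t in (0 : ℝ)..(-r), z (-t) := by
      rw [intervalIntegral.integral_comp_neg, neg_neg, neg_zero, intervalIntegral.integral_symm]
    rw [hsub, abs_neg]
    refine key (-r) (fun t => z (-t)) (by linarith) fun t ht => ?_
    have := h (-t) (by rw [uIcc_of_ge hr]; constructor <;> linarith [ht.1, ht.2])
      (by linarith [ht.1])
    rwa [abs_neg, abs_of_pos ht.1] at this

lemma abs_volterra_integral_le {lam C D r : ℝ} (hlam : 0 < lam) (hC : 0 ≤ C) (hD : 0 ≤ D)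
    {e h : ℝ → ℝ} (he : ∀ t ∈ uIcc 0 r, |e t| ≤ D * Real.exp (lam * |t|))
    (hh : ∀ s ∈ uIcc 0 r, s ≠ 0 → |h s| * |s| ≤ C * |∫ t in (0 : ℝ)..s, e t|) :
    |∫ t in (0 : ℝ)..r, h t| ≤ C * D / lam * Real.exp (lam * |r|) := by
  refine abs_integral_le_of_exp_bound hlam (by positivity) fun s hs hs0 => ?_
  have h1 : |∫ t in (0 : ℝ)..s, e t| ≤ D * Real.exp (lam * |s|) * |s - 0| := by
    rw [← Real.norm_eq_abs]
    refine intervalIntegral.norm_integral_le_of_norm_le_const fun t ht => ?_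
    rw [Real.norm_eq_abs]
    have hts : t ∈ uIcc 0 s := uIoc_subset_uIcc ht
    have hle : |t| ≤ |s| := by
      have := abs_sub_left_of_mem_uIcc hts
      simpa using this
    refine (he t (uIcc_subset_uIcc_left hs hts)).trans ?_
    gcongr
  have hpos : 0 < |s| := abs_pos.2 hs0
  have h2 := (hh s hs hs0).trans (mul_le_mul_of_nonneg_left h1 hC)
  rw [sub_zero] at h2
  refine le_of_mul_le_mul_right (h2.trans_eq ?_) hpos
  ring

lemma eqOn_zero_of_volterra {K C r : ℝ} (hK : 0 ≤ K) (hC : 0 ≤ C) {e h : ℝ → ℝ}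
    (hc : ContinuousOn e (uIcc 0 r))
    (heh : ∀ t ∈ uIcc 0 r, |e t| ≤ K * |∫ s in (0 : ℝ)..t, h s|)
    (hh : ∀ s ∈ uIcc 0 r, s ≠ 0 → |h s| * |s| ≤ C * |∫ t in (0 : ℝ)..s, e t|) :
    ∀ t ∈ uIcc 0 r, e t = 0 := by
  set lam : ℝ := 2 * (K * C) + 1 with hlam_def
  have hlam : 0 < lam := by positivity
  have hcw : ContinuousOn (fun t => |e t| * Real.exp (-(lam * |t|))) (uIcc 0 r) :=
    hc.abs.mul (Continuous.continuousOn (by fun_prop))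
  obtain ⟨t₀, ht₀, hmax⟩ := isCompact_uIcc.exists_isMaxOn nonempty_uIcc hcw
  set m := |e t₀| * Real.exp (-(lam * |t₀|)) with hm
  have hm0 : 0 ≤ m := by positivity
  have hbound : ∀ t ∈ uIcc 0 r, |e t| ≤ m * Real.exp (lam * |t|) := by
    intro t ht
    have h1 : |e t| * Real.exp (-(lam * |t|)) ≤ m := hmax ht
    rw [Real.exp_neg, ← div_eq_mul_inv, div_le_iff₀ (Real.exp_pos _)] at h1
    exact h1
  have hsub : uIcc 0 t₀ ⊆ uIcc 0 r := uIcc_subset_uIcc_left ht₀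
  have h1 := abs_volterra_integral_le hlam hC hm0 (fun t ht => hbound t (hsub ht))
    (fun s hs => hh s (hsub hs))
  have h2 : |e t₀| ≤ K * (C * m / lam * Real.exp (lam * |t₀|)) :=
    (heh t₀ ht₀).trans (mul_le_mul_of_nonneg_left h1 hK)
  have h3 : m ≤ K * (C * m / lam) := by
    have hm' : |e t₀| = m * Real.exp (lam * |t₀|) := by
      rw [hm, mul_assoc, ← Real.exp_add, neg_add_cancel, Real.exp_zero, mul_one]
    rw [hm', ← mul_assoc] at h2
    exact le_of_mul_le_mul_right h2 (Real.exp_pos _)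
  have h4 : m * lam ≤ K * C * m := by
    rw [← le_div_iff₀ hlam]
    refine h3.trans_eq ?_
    ring
  have h5 : m = 0 := by nlinarith [mul_nonneg (mul_nonneg hK hC) hm0]
  intro t ht
  have := hbound t ht
  rw [h5, zero_mul] at this
  exact abs_nonpos_iff.1 this

/-- The nonlinear Volterra integrand: `A s` times the difference quotient between `0` and `s` of
`s ↦ g (b + ∫₀ˢ w)`. -/
noncomputable def volterraIntegrand (A g : ℝ → ℝ) (b : ℝ) (w : ℝ → ℝ) (s : ℝ) : ℝ :=
  A s * dslope (fun s => g (b + ∫ t in (0 : ℝ)..s, w t)) 0 s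

lemma hasDerivAt_const_add_integral {w : ℝ → ℝ} (hw : Continuous w) (b s : ℝ) :
    HasDerivAt (fun s => b + ∫ t in (0 : ℝ)..s, w t) (w s) s :=
  (hw.integral_hasStrictDerivAt 0 s).hasDerivAt.const_add b

lemma hasDerivAt_comp_const_add_integral {g : ℝ → ℝ} {b g' : ℝ} (hg' : HasDerivAt g g' b)
    {w : ℝ → ℝ} (hw : Continuous w) :
    HasDerivAt (fun s => g (b + ∫ t in (0 : ℝ)..s, w t)) (g' * w 0) 0 := by
  refine HasDerivAt.comp (0 : ℝ) (h₂ := g) ?_ (hasDerivAt_const_add_integral hw b 0)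
  simpa using hg'

lemma continuous_volterraIntegrand {A g : ℝ → ℝ} {b g' : ℝ} (hA : Continuous A)
    (hg : Continuous g) (hg' : HasDerivAt g g' b) {w : ℝ → ℝ} (hw : Continuous w) :
    Continuous (volterraIntegrand A g b w) := by
  refine hA.mul (continuous_iff_continuousAt.2 fun s => ?_)
  rcases eq_or_ne s 0 with rfl | hs
  · exact continuousAt_dslope_same.2 (hasDerivAt_comp_const_add_integral hg' hw).differentiableAt
  · rw [continuousAt_dslope_of_ne hs]
    have : Continuous fun s => b + ∫ t in (0 : ℝ)..s, w t :=
      continuous_iff_continuousAt.2 fun s => (hasDerivAt_const_add_integral hw b s).continuousAt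
    exact (hg.comp this).continuousAt

lemma volterraIntegrand_mul_self {A g : ℝ → ℝ} {b : ℝ} (hb : g b = 0) (w : ℝ → ℝ) (s : ℝ) :
    volterraIntegrand A g b w s * s = A s * g (b + ∫ t in (0 : ℝ)..s, w t) := by
  have := sub_smul_dslope (fun s => g (b + ∫ t in (0 : ℝ)..s, w t)) 0 s
  simp only [smul_eq_mul, sub_zero, intervalIntegral.integral_same, add_zero, hb] at this
  rw [volterraIntegrand, mul_assoc, mul_comm _ s, this]

lemma abs_volterraIntegrand_sub_le {A g : ℝ → ℝ} {b K : ℝ} {L : NNReal}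
    (hAK : ∀ s, |A s| ≤ K) (hg : LipschitzWith L g) (hb : g b = 0) {w v : ℝ → ℝ}
    (hw : Continuous w) (hv : Continuous v) (s : ℝ) :
    |volterraIntegrand A g b w s - volterraIntegrand A g b v s| * |s|
      ≤ K * L * |∫ t in (0 : ℝ)..s, (w t - v t)| := by
  rw [← abs_mul, sub_mul, volterraIntegrand_mul_self hb, volterraIntegrand_mul_self hb, ← mul_sub,
    abs_mul, mul_assoc, intervalIntegral.integral_sub (hw.intervalIntegrable _ _)
      (hv.intervalIntegrable _ _)]
  refine mul_le_mul (hAK s) ?_ (abs_nonneg _) ((abs_nonneg _).trans (hAK s))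
  have := hg.dist_le_mul (b + ∫ t in (0 : ℝ)..s, w t) (b + ∫ t in (0 : ℝ)..s, v t)
  rwa [Real.dist_eq, Real.dist_eq, add_sub_add_left_eq_sub] at this

lemma exists_volterra_solution {A B g : ℝ → ℝ} {b g' K : ℝ} {L : NNReal} (a : ℝ)
    (hA : Continuous A) (hB : Continuous B) (hAK : ∀ s, |A s| ≤ K) (hBK : ∀ s, |B s| ≤ K)
    (hg : LipschitzWith L g) (hg' : HasDerivAt g g' b) (hb : g b = 0) :
    ∃ w : ℝ → ℝ, Continuous w ∧
      ∀ r, w r = B r * (a + ∫ s in (0 : ℝ)..r, volterraIntegrand A g b w s) := by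
  have hK : 0 ≤ K := (abs_nonneg _).trans (hAK 0)
  set lam : ℝ := 2 * (K * (K * L)) + 1 with hlam_def
  have hlam : 0 < lam := by positivity
  have hwc : ∀ y : BoundedContinuousFunction ℝ ℝ,
      Continuous fun t => Real.exp (lam * |t|) * y t := fun y => by fun_prop
  have hPc : ∀ y : BoundedContinuousFunction ℝ ℝ,
      Continuous (volterraIntegrand A g b fun t => Real.exp (lam * |t|) * y t) := fun y =>
    continuous_volterraIntegrand hA hg.continuous hg' (hwc y)
  have hexp : ∀ r, Real.exp (-(lam * |r|)) * Real.exp (lam * |r|) = 1 := fun r => by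
    rw [← Real.exp_add, neg_add_cancel, Real.exp_zero]
  have hdiff : ∀ y z : BoundedContinuousFunction ℝ ℝ, ∀ r,
      |(∫ s in (0 : ℝ)..r, volterraIntegrand A g b (fun t => Real.exp (lam * |t|) * y t) s)
        - ∫ s in (0 : ℝ)..r, volterraIntegrand A g b (fun t => Real.exp (lam * |t|) * z t) s|
      ≤ K * L * dist y z / lam * Real.exp (lam * |r|) := by
    intro y z r
    rw [← intervalIntegral.integral_sub ((hPc y).intervalIntegrable _ _)
      ((hPc z).intervalIntegrable _ _)]
    refine abs_volterra_integral_le hlam (by positivity) dist_nonneg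
      (e := fun t => Real.exp (lam * |t|) * y t - Real.exp (lam * |t|) * z t) (fun t _ => ?_)
      (fun s _ _ => abs_volterraIntegrand_sub_le hAK hg hb (hwc y) (hwc z) s)
    rw [← mul_sub, abs_mul, abs_of_pos (Real.exp_pos _), mul_comm]
    gcongr
    rw [← Real.dist_eq]
    exact BoundedContinuousFunction.dist_coe_le_dist t
  have hzero : ∀ r, volterraIntegrand A g b
      (fun t => Real.exp (lam * |t|) * (0 : BoundedContinuousFunction ℝ ℝ) t) r = 0 := by
    intro r
    have h1 := volterraIntegrand_mul_self (A := A) hb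
      (fun t => Real.exp (lam * |t|) * (0 : BoundedContinuousFunction ℝ ℝ) t) r
    rcases eq_or_ne r 0 with rfl | hr
    · simp [volterraIntegrand]
    · simpa [hb, hr] using h1
  have hbound : ∀ y : BoundedContinuousFunction ℝ ℝ, ∀ r,
      ‖Real.exp (-(lam * |r|)) * (B r * (a + ∫ s in (0 : ℝ)..r,
        volterraIntegrand A g b (fun t => Real.exp (lam * |t|) * y t) s))‖
      ≤ K * (|a| + K * L * dist y 0 / lam) := by
    intro y r
    have h1 := hdiff y 0 r
    simp only [hzero, intervalIntegral.integral_zero, sub_zero] at h1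
    rw [norm_mul, norm_mul, Real.norm_eq_abs, Real.norm_eq_abs, Real.norm_eq_abs,
      abs_of_pos (Real.exp_pos _), mul_left_comm]
    refine mul_le_mul (hBK r) ?_ (by positivity) hK
    refine (mul_le_mul_of_nonneg_left ((abs_add_le _ _).trans (add_le_add_right h1 _))
      (Real.exp_pos _).le).trans ?_
    rw [mul_add, mul_left_comm, hexp, mul_one]
    gcongr
    have : Real.exp (-(lam * |r|)) ≤ 1 := Real.exp_le_one_iff.2 (by
      have : 0 ≤ lam * |r| := by positivity
      linarith)
    nlinarith [abs_nonneg a]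
  let op : BoundedContinuousFunction ℝ ℝ → BoundedContinuousFunction ℝ ℝ := fun y =>
    BoundedContinuousFunction.ofNormedAddCommGroup
      (fun r => Real.exp (-(lam * |r|)) * (B r * (a + ∫ s in (0 : ℝ)..r,
        volterraIntegrand A g b (fun t => Real.exp (lam * |t|) * y t) s)))
      (by
        have := intervalIntegral.continuous_primitive (μ := MeasureTheory.volume)
          (fun x y' => (hPc y).intervalIntegrable x y') 0
        fun_prop) _ (hbound y)
  have hop : ∀ y r, op y r = Real.exp (-(lam * |r|)) * (B r * (a + ∫ s in (0 : ℝ)..r,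
      volterraIntegrand A g b (fun t => Real.exp (lam * |t|) * y t) s)) := fun _ _ => rfl
  have hcontr : ContractingWith (1 / 2 : NNReal) op := by
    refine ⟨by norm_num [← NNReal.coe_lt_coe], LipschitzWith.of_dist_le_mul fun y z => ?_⟩
    rw [BoundedContinuousFunction.dist_le (by positivity)]
    intro r
    rw [hop, hop, Real.dist_eq, ← mul_sub, ← mul_sub, add_sub_add_left_eq_sub, abs_mul, abs_mul,
      abs_of_pos (Real.exp_pos _)]
    have h1 : |B r| * |(∫ s in (0 : ℝ)..r,
          volterraIntegrand A g b (fun t => Real.exp (lam * |t|) * y t) s)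
        - ∫ s in (0 : ℝ)..r, volterraIntegrand A g b (fun t => Real.exp (lam * |t|) * z t) s|
        ≤ K * (K * L * dist y z / lam * Real.exp (lam * |r|)) :=
      mul_le_mul (hBK r) (hdiff y z r) (abs_nonneg _) hK
    refine (mul_le_mul_of_nonneg_left h1 (Real.exp_pos _).le).trans ?_
    have h2 : Real.exp (-(lam * |r|)) * (K * (K * L * dist y z / lam * Real.exp (lam * |r|)))
        = K * (K * L) / lam * dist y z := by
      linear_combination (K * (K * L * dist y z / lam)) * hexp r
    rw [h2]
    refine mul_le_mul_of_nonneg_right ?_ dist_nonneg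
    rw [div_le_iff₀ hlam]
    push_cast
    linarith
  have hfix := hcontr.fixedPoint_isFixedPt
  set y := ContractingWith.fixedPoint op hcontr
  refine ⟨fun t => Real.exp (lam * |t|) * y t, hwc y, fun r => ?_⟩
  have h1 : y r = op y r := by rw [hfix.eq]
  have h2 := hop y r
  simp only
  rw [h1, h2, ← mul_assoc, mul_comm (Real.exp (lam * |r|)), hexp, one_mul]

/-- `u` is a `C²` solution on `(c, d)` of `(1 - ρ²) (u'' + (k / ρ) u') = g u` with `u 1 = b` and
`u' 1 = a`. -/
structure IsRadialSolution (k : ℕ) (g : ℝ → ℝ) (b a c d : ℝ) (u : ℝ → ℝ) : Prop where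
  contDiffOn : ContDiffOn ℝ 2 u (Ioo c d)
  eqn : ∀ ρ ∈ Ioo c d, (1 - ρ ^ 2) * (deriv (deriv u) ρ + k / ρ * deriv u ρ) = g (u ρ)
  val_one : u 1 = b
  deriv_one : deriv u 1 = a

lemma contDiffOn_two_iff_of_isOpen {u : ℝ → ℝ} {s : Set ℝ} (hs : IsOpen s) :
    ContDiffOn ℝ 2 u s ↔
      DifferentiableOn ℝ u s ∧ DifferentiableOn ℝ (deriv u) s ∧
        ContinuousOn (deriv (deriv u)) s := by
  rw [show (2 : WithTop ℕ∞) = 1 + 1 by norm_num, contDiffOn_succ_iff_deriv_of_isOpen hs,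
    show (1 : WithTop ℕ∞) = 0 + 1 by norm_num, contDiffOn_succ_iff_deriv_of_isOpen hs]
  simp

namespace IsRadialSolution

variable {k : ℕ} {g : ℝ → ℝ} {b a c d : ℝ} {u v : ℝ → ℝ}

lemma hasDerivAt (h : IsRadialSolution k g b a c d u) {ρ : ℝ} (hρ : ρ ∈ Ioo c d) :
    HasDerivAt u (deriv u ρ) ρ :=
  (((contDiffOn_two_iff_of_isOpen isOpen_Ioo).1 h.contDiffOn).1.differentiableAt
    (isOpen_Ioo.mem_nhds hρ)).hasDerivAt

lemma hasDerivAt_deriv (h : IsRadialSolution k g b a c d u) {ρ : ℝ} (hρ : ρ ∈ Ioo c d) :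
    HasDerivAt (deriv u) (deriv (deriv u) ρ) ρ :=
  (((contDiffOn_two_iff_of_isOpen isOpen_Ioo).1 h.contDiffOn).2.1.differentiableAt
    (isOpen_Ioo.mem_nhds hρ)).hasDerivAt

lemma continuousOn_deriv (h : IsRadialSolution k g b a c d u) :
    ContinuousOn (deriv u) (Ioo c d) := fun _ hρ =>
  (h.hasDerivAt_deriv hρ).continuousAt.continuousWithinAt

lemma continuousOn_deriv_deriv (h : IsRadialSolution k g b a c d u) :
    ContinuousOn (deriv (deriv u)) (Ioo c d) :=
  ((contDiffOn_two_iff_of_isOpen isOpen_Ioo).1 h.contDiffOn).2.2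

lemma continuousOn (h : IsRadialSolution k g b a c d u) : ContinuousOn u (Ioo c d) :=
  h.contDiffOn.continuousOn

lemma mono (h : IsRadialSolution k g b a c d u) {c' d' : ℝ} (hc : c ≤ c') (hd : d' ≤ d) :
    IsRadialSolution k g b a c' d' u :=
  ⟨h.contDiffOn.mono (Ioo_subset_Ioo hc hd), fun ρ hρ => h.eqn ρ (Ioo_subset_Ioo hc hd hρ), h.val_one,
    h.deriv_one⟩

lemma hasDerivAt_flux (h : IsRadialSolution k g b a c d u) (hc : 0 ≤ c) {ρ : ℝ}
    (hρ : ρ ∈ Ioo c d) :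
    HasDerivAt (fun ρ => ρ ^ k * deriv u ρ)
      (ρ ^ k * (deriv (deriv u) ρ + k / ρ * deriv u ρ)) ρ := by
  have hρ0 : ρ ≠ 0 := (hc.trans_lt hρ.1).ne'
  refine ((hasDerivAt_pow k ρ).mul (h.hasDerivAt_deriv hρ)).congr_deriv ?_
  rcases k with _ | k
  · simp
  · rw [Nat.add_sub_cancel]
    field_simp
    ring

theorem eqOn (hu : IsRadialSolution k g b a c d u) (hv : IsRadialSolution k g b a c d v)
    (hc : 0 ≤ c) (hc1 : c < 1) (hd1 : 1 < d)
    (hg : ∀ M : ℝ, ∃ L : NNReal, LipschitzOnWith L g (Icc (-M) M)) : EqOn u v (Ioo c d) := by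
  intro ρ₁ hρ₁
  set r := ρ₁ - 1 with hr
  have hmaps : MapsTo (fun t : ℝ => 1 + t) (uIcc 0 r) (uIcc 1 ρ₁) := by
    intro t ht
    rw [mem_uIcc] at ht ⊢
    rcases ht with ht | ht
    · left; constructor <;> linarith [ht.1, ht.2]
    · right; constructor <;> linarith [ht.1, ht.2]
  have hsub : uIcc 1 ρ₁ ⊆ Ioo c d := ordConnected_Ioo.uIcc_subset ⟨hc1, hd1⟩ hρ₁
  have hmem : ∀ t ∈ uIcc 0 r, 1 + t ∈ Ioo c d := fun t ht => hsub (hmaps ht)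
  obtain ⟨M₁, hM₁⟩ := isCompact_uIcc.exists_bound_of_continuousOn (hu.continuousOn.mono hsub)
  obtain ⟨M₂, hM₂⟩ := isCompact_uIcc.exists_bound_of_continuousOn (hv.continuousOn.mono hsub)
  obtain ⟨L, hL⟩ := hg (max M₁ M₂)
  have hm0 : 0 < min 1 ρ₁ := lt_min one_pos (hc.trans_lt hρ₁.1)
  have hshift : ∀ {f : ℝ → ℝ}, ContinuousOn f (Ioo c d) →
      ContinuousOn (fun t => f (1 + t)) (uIcc 0 r) := fun hf =>
    hf.comp (Continuous.continuousOn (by fun_prop)) hmem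
  have hflux_cont : ∀ {w : ℝ → ℝ}, IsRadialSolution k g b a c d w → ContinuousOn
      (fun ρ => ρ ^ k * (deriv (deriv w) ρ + k / ρ * deriv w ρ)) (Ioo c d) := fun hw =>
    (continuous_pow k).continuousOn.mul (hw.continuousOn_deriv_deriv.add
      ((continuousOn_const.div continuousOn_id fun ρ hρ => (hc.trans_lt hρ.1).ne').mul
        hw.continuousOn_deriv))
  set e : ℝ → ℝ := fun t => deriv u (1 + t) - deriv v (1 + t) with he
  set h : ℝ → ℝ := fun t =>
    (1 + t) ^ k * (deriv (deriv u) (1 + t) + k / (1 + t) * deriv u (1 + t))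
      - (1 + t) ^ k * (deriv (deriv v) (1 + t) + k / (1 + t) * deriv v (1 + t)) with hh
  have hec : ContinuousOn e (uIcc 0 r) :=
    (hshift hu.continuousOn_deriv).sub (hshift hv.continuousOn_deriv)
  have hhc : ContinuousOn h (uIcc 0 r) :=
    (hshift (hflux_cont hu)).sub (hshift (hflux_cont hv))
  have hint_e : ∀ s ∈ uIcc 0 r, ∫ t in (0 : ℝ)..s, e t = u (1 + s) - v (1 + s) := by
    intro s hs
    have hss := uIcc_subset_uIcc_left hs
    rw [intervalIntegral.integral_eq_sub_of_hasDerivAt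
      (f := fun t => u (1 + t) - v (1 + t)) (fun t ht => ?_)
      (hec.mono hss).intervalIntegrable]
    · simp [hu.val_one, hv.val_one]
    · exact ((hu.hasDerivAt (hmem t (hss ht))).comp_const_add 1 t).sub
        ((hv.hasDerivAt (hmem t (hss ht))).comp_const_add 1 t)
  have hint_h : ∀ s ∈ uIcc 0 r, ∫ t in (0 : ℝ)..s, h t = (1 + s) ^ k * e s := by
    intro s hs
    have hss := uIcc_subset_uIcc_left hs
    rw [intervalIntegral.integral_eq_sub_of_hasDerivAt
      (f := fun t => (1 + t) ^ k * deriv u (1 + t) - (1 + t) ^ k * deriv v (1 + t))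
      (fun t ht => ?_) (hhc.mono hss).intervalIntegrable]
    · simp only [add_zero, hu.deriv_one, hv.deriv_one, sub_self, sub_zero, he]
      ring
    · exact ((hu.hasDerivAt_flux hc (hmem t (hss ht))).comp_const_add 1 t).sub
        ((hv.hasDerivAt_flux hc (hmem t (hss ht))).comp_const_add 1 t)
  have hzero := eqOn_zero_of_volterra (K := ((min 1 ρ₁) ^ k)⁻¹) (C := (max 1 ρ₁) ^ k * L)
    (r := r) (by positivity) (by positivity) hec (h := h) (fun t ht => ?_) (fun s hs _ => ?_)
  · have h1 := hint_e r right_mem_uIcc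
    rw [intervalIntegral.integral_congr (g := fun _ => (0 : ℝ)) hzero,
      intervalIntegral.integral_zero] at h1
    have h2 : 1 + r = ρ₁ := by rw [hr]; ring
    rw [h2] at h1
    linarith
  · rw [hint_h t ht, abs_mul, ← mul_assoc]
    have h1 : min 1 ρ₁ ≤ 1 + t := (hmaps ht).1
    rw [abs_of_pos (pow_pos (hm0.trans_le h1) k)]
    refine le_mul_of_one_le_left (abs_nonneg _) ?_
    rw [inv_mul_eq_div, one_le_div (pow_pos hm0 k)]
    exact pow_le_pow_left₀ hm0.le h1 k
  · have hs' := hmem s hs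
    have hpos : 0 < 1 + s := hc.trans_lt hs'.1
    rw [hint_e s hs, mul_assoc]
    have h1 : h s * (-s * (2 + s)) = (1 + s) ^ k * (g (u (1 + s)) - g (v (1 + s))) := by
      rw [← hu.eqn _ hs', ← hv.eqn _ hs', hh]
      ring
    have h2 : |g (u (1 + s)) - g (v (1 + s))| ≤ L * |u (1 + s) - v (1 + s)| :=
      hL.dist_le_mul _ (abs_le.1 ((hM₁ _ (hmaps hs)).trans (le_max_left _ _)))
        _ (abs_le.1 ((hM₂ _ (hmaps hs)).trans (le_max_right _ _)))
    have h3 : |h s| * |s| * (2 + s)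
        = (1 + s) ^ k * |g (u (1 + s)) - g (v (1 + s))| := by
      have := congrArg abs h1
      rwa [abs_mul, abs_mul, abs_mul, abs_neg, abs_of_pos (by linarith : 0 < 2 + s),
        abs_of_pos (pow_pos hpos k), ← mul_assoc] at this
    calc |h s| * |s| ≤ |h s| * |s| * (2 + s) :=
          le_mul_of_one_le_right (by positivity) (by linarith)
      _ = (1 + s) ^ k * |g (u (1 + s)) - g (v (1 + s))| := h3
      _ ≤ (max 1 ρ₁) ^ k * (L * |u (1 + s) - v (1 + s)|) := by
          refine mul_le_mul (pow_le_pow_left₀ hpos.le (hmaps hs).2 k) h2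
            (abs_nonneg _) (by positivity)

/-- Along solutions `(ρᵏ u')² / 2 + ρ²ᵏ G(u) / (1 - ρ²)`, with `G' = -g`, is nondecreasing on
`(c, 1)`; its limit at `1` is `a² / 2`. -/
theorem abs_pow_mul_deriv_le (h : IsRadialSolution k g b a c d u) (hc : 0 ≤ c) (hd1 : 1 < d)
    {G : ℝ → ℝ} (hG : ∀ x, HasDerivAt G (-g x) x) (hG0 : ∀ x, 0 ≤ G x) (hGb : G b = 0)
    (hgb : g b = 0) {ρ : ℝ} (hρ : ρ ∈ Ioo c 1) : |ρ ^ k * deriv u ρ| ≤ |a| := by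
  have hsub : Ioo c 1 ⊆ Ioo c d := Ioo_subset_Ioo_right hd1.le
  have h1mem : (1 : ℝ) ∈ Ioo c d := ⟨hρ.1.trans hρ.2, hd1⟩
  set Q : ℝ → ℝ := fun ρ =>
    (ρ ^ k * deriv u ρ) ^ 2 / 2 + G (u ρ) * ((ρ ^ k) ^ 2 / (1 - ρ ^ 2)) with hQ
  have hQ' : ∀ x ∈ Ioo c 1, HasDerivAt Q
      (G (u x) * ((2 * (x ^ k) * (k * x ^ (k - 1)) * (1 - x ^ 2) + (x ^ k) ^ 2 * (2 * x))
        / (1 - x ^ 2) ^ 2)) x := by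
    intro x hx
    have hx0 : 0 < x := hc.trans_lt hx.1
    have hx1 : 1 - x ^ 2 ≠ 0 := by nlinarith [hx.2]
    have e := h.eqn x (hsub hx)
    have d1 := ((h.hasDerivAt_flux hc (hsub hx)).pow 2).div_const 2
    have d2 := (hG (u x)).comp x (h.hasDerivAt (hsub hx))
    have d3 := ((hasDerivAt_pow k x).pow 2).div ((hasDerivAt_pow 2 x).const_sub 1) hx1
    refine (d1.add (d2.mul d3)).congr_deriv ?_
    simp only [Function.comp_apply, Pi.pow_apply, Pi.div_apply]
    rw [← e]
    field_simp
    push_cast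
    ring
  have hmono : MonotoneOn Q (Ioo c 1) := by
    refine monotoneOn_of_deriv_nonneg (convex_Ioo c 1)
      (fun x hx => (hQ' x hx).continuousAt.continuousWithinAt)
      (fun x hx => (hQ' x (interior_subset hx)).differentiableAt.differentiableWithinAt)
      fun x hx => ?_
    have hx := interior_subset hx
    rw [(hQ' x hx).deriv]
    have hx0 : 0 < x := hc.trans_lt hx.1
    have hx1 : 0 ≤ 1 - x ^ 2 := by nlinarith [hx.2]
    have := hG0 (u x)
    positivity
  have hlim : Tendsto Q (nhdsWithin 1 (Iio 1)) (nhds (a ^ 2 / 2)) := by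
    have l1 : Tendsto (fun ρ => (ρ ^ k * deriv u ρ) ^ 2 / 2) (nhdsWithin 1 (Iio 1))
        (nhds (a ^ 2 / 2)) := by
      have := (((h.hasDerivAt_flux hc h1mem).continuousAt.pow 2).div_const 2).tendsto
      simpa [h.deriv_one] using this.mono_left nhdsWithin_le_nhds
    have l2 : Tendsto (slope (fun ρ => G (u ρ)) 1) (nhdsWithin 1 (Iio 1)) (nhds 0) := by
      have d2 : HasDerivAt (fun ρ => G (u ρ)) (-g (u 1) * deriv u 1) 1 :=
        (hG (u 1)).comp 1 (h.hasDerivAt h1mem)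
      rw [h.val_one, hgb, neg_zero, zero_mul] at d2
      exact (hasDerivAt_iff_tendsto_slope.1 d2).mono_left
        (nhdsWithin_mono _ fun x hx => ne_of_lt hx)
    have l3 : Tendsto (fun ρ : ℝ => -((ρ ^ k) ^ 2 / (1 + ρ))) (nhdsWithin 1 (Iio 1))
        (nhds (-(((1 : ℝ) ^ k) ^ 2 / (1 + 1)))) := by
      refine Tendsto.mono_left (ContinuousAt.tendsto ?_) nhdsWithin_le_nhds
      exact (ContinuousAt.div (by fun_prop) (by fun_prop) (by norm_num)).neg
    have l4 := l1.add (l2.mul l3)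
    rw [zero_mul, add_zero] at l4
    refine l4.congr' ?_
    filter_upwards [Ioo_mem_nhdsLT (zero_lt_one' ℝ)] with x hx
    have hx1 : 1 - x ^ 2 ≠ 0 := by nlinarith [hx.1, hx.2]
    have hx2 : x - 1 ≠ 0 := by linarith [hx.2]
    have hx3 : 1 + x ≠ 0 := by linarith [hx.1]
    rw [hQ, slope_def_field, h.val_one, hGb, sub_zero]
    simp only
    rw [show 1 - x ^ 2 = -(x - 1) * (1 + x) by ring]
    field_simp
  have hle : Q ρ ≤ a ^ 2 / 2 := by
    refine ge_of_tendsto hlim ?_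
    filter_upwards [Ioo_mem_nhdsLT hρ.2] with x hx
    exact hmono hρ ⟨hρ.1.trans hx.1, hx.2⟩ hx.1.le
  have hρ0 : 0 < ρ := hc.trans_lt hρ.1
  have hρ1 : 0 ≤ 1 - ρ ^ 2 := by nlinarith [hρ.2]
  have hnn : 0 ≤ G (u ρ) * ((ρ ^ k) ^ 2 / (1 - ρ ^ 2)) := by
    have := hG0 (u ρ)
    positivity
  rw [← sq_le_sq]
  simp only [hQ] at hle
  linarith

end IsRadialSolution

theorem exists_isRadialSolution_of_lipschitz (k : ℕ) {g : ℝ → ℝ} {L : NNReal} {b g' c : ℝ}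
    (a : ℝ) (hc : 0 < c) (hc1 : c < 1) (hg : LipschitzWith L g) (hg' : HasDerivAt g g' b)
    (hb : g b = 0) :
    ∃ u, IsRadialSolution k g b a c 2 u ∧ deriv (deriv u) 1 = -(k * a) - g' * a / 2 := by
  set cl : ℝ → ℝ := fun s => max c (min (1 + s) 2) with hcl
  have hclc : Continuous cl := by fun_prop
  have hcl0 : ∀ s, 0 < cl s := fun s => hc.trans_le (le_max_left _ _)
  have hcl2 : ∀ s, cl s ≤ 2 := fun s => max_le (by linarith) (min_le_right _ _)
  have hcl_eq : ∀ ρ ∈ Ioo c 2, cl (ρ - 1) = ρ := fun ρ hρ => by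
    simp only [hcl, add_sub_cancel]
    rw [min_eq_left hρ.2.le, max_eq_right hρ.1.le]
  set A : ℝ → ℝ := fun s => -(cl s ^ k / (1 + cl s)) with hA
  set B : ℝ → ℝ := fun s => (cl s ^ k)⁻¹ with hB
  have hAc : Continuous A :=
    ((hclc.pow k).div (by fun_prop) fun s => by linarith [hcl0 s]).neg
  have hBc : Continuous B := (hclc.pow k).inv₀ fun s => (pow_pos (hcl0 s) k).ne'
  have hAK : ∀ s, |A s| ≤ 2 ^ k + (c ^ k)⁻¹ := by
    intro s
    have h0 := hcl0 s
    rw [hA, abs_neg, abs_of_pos (by positivity)]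
    have h1 : cl s ^ k / (1 + cl s) ≤ cl s ^ k :=
      div_le_self (by positivity) (by linarith)
    have h2 : cl s ^ k ≤ 2 ^ k := pow_le_pow_left₀ h0.le (hcl2 s) k
    have h3 : 0 < (c ^ k)⁻¹ := by positivity
    linarith
  have hBK : ∀ s, |B s| ≤ 2 ^ k + (c ^ k)⁻¹ := by
    intro s
    have h0 := hcl0 s
    rw [hB, abs_of_pos (by positivity)]
    have h1 : (cl s ^ k)⁻¹ ≤ (c ^ k)⁻¹ :=
      inv_anti₀ (by positivity) (pow_le_pow_left₀ hc.le (le_max_left _ _) k)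
    have h2 : (0 : ℝ) < 2 ^ k := by positivity
    linarith
  obtain ⟨w, hwc, hw⟩ := exists_volterra_solution a hAc hBc hAK hBK hg hg' hb
  set P := volterraIntegrand A g b w with hP
  have hPc : Continuous P := continuous_volterraIntegrand hAc hg.continuous hg' hwc
  set u : ℝ → ℝ := fun ρ => b + ∫ t in (0 : ℝ)..(ρ - 1), w t with hu
  have hu' : ∀ ρ, HasDerivAt u (w (ρ - 1)) ρ := fun ρ =>
    (hasDerivAt_const_add_integral hwc b (ρ - 1)).comp_sub_const ρ 1
  have hderiv : deriv u = fun ρ => w (ρ - 1) := funext fun ρ => (hu' ρ).deriv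
  have hu'' : ∀ ρ ∈ Ioo c 2, HasDerivAt (deriv u)
      (-(k / ρ * w (ρ - 1)) + (ρ ^ k)⁻¹ * P (ρ - 1)) ρ := by
    intro ρ hρ
    have hρ0 : 0 < ρ := hc.trans hρ.1
    have hJ : HasDerivAt (fun ρ => a + ∫ s in (0 : ℝ)..(ρ - 1), P s) (P (ρ - 1)) ρ :=
      (hasDerivAt_const_add_integral hPc a (ρ - 1)).comp_sub_const ρ 1
    have hprod := ((hasDerivAt_pow k ρ).inv (pow_pos hρ0 k).ne').mul hJ
    have heq : deriv u =ᶠ[nhds ρ]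
        (fun ρ => ρ ^ k)⁻¹ * fun ρ => a + ∫ s in (0 : ℝ)..(ρ - 1), P s := by
      filter_upwards [isOpen_Ioo.mem_nhds hρ] with x hx
      rw [hderiv]
      simp only [hw (x - 1), hB, hcl_eq x hx, Pi.mul_apply, Pi.inv_apply, hP]
    refine (hprod.congr_of_eventuallyEq heq).congr_deriv ?_
    rw [hw (ρ - 1)]
    simp only [hB, hcl_eq ρ hρ, Pi.inv_apply]
    rcases k with _ | k
    · simp
    · rw [Nat.add_sub_cancel]
      field_simp
      ring
  have hD2 : ∀ ρ ∈ Ioo c 2,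
      deriv (deriv u) ρ = -(k / ρ * w (ρ - 1)) + (ρ ^ k)⁻¹ * P (ρ - 1) := fun ρ hρ =>
    (hu'' ρ hρ).deriv
  have h1mem : (1 : ℝ) ∈ Ioo c 2 := ⟨hc1, by norm_num⟩
  have hw0 : w 0 = a := by
    rw [hw 0]
    have := hcl_eq 1 h1mem
    rw [sub_self] at this
    simp [hB, this]
  refine ⟨u, ⟨?_, fun ρ hρ => ?_, by simp [hu], by simp [hderiv, hw0]⟩, ?_⟩
  · refine (contDiffOn_two_iff_of_isOpen isOpen_Ioo).2
      ⟨fun ρ _ => (hu' ρ).differentiableAt.differentiableWithinAt,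
        fun ρ hρ => (hu'' ρ hρ).differentiableAt.differentiableWithinAt, ?_⟩
    refine ContinuousOn.congr (fun ρ hρ => ContinuousAt.continuousWithinAt ?_) hD2
    have hρ0 : ρ ≠ 0 := (hc.trans hρ.1).ne'
    have hρk : ρ ^ k ≠ 0 := pow_ne_zero k hρ0
    fun_prop (disch := assumption)
  · have hρ0 : 0 < ρ := hc.trans hρ.1
    have hPe := volterraIntegrand_mul_self (A := A) hb w (ρ - 1)
    have hAe : A (ρ - 1) = -(ρ ^ k / (1 + ρ)) := by simp only [hA, hcl_eq ρ hρ]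
    rw [← hP, hAe] at hPe
    rw [hD2 ρ hρ, hderiv]
    have h2 : g (u ρ) = -((1 + ρ) / ρ ^ k) * (P (ρ - 1) * (ρ - 1)) := by
      rw [hPe]
      field_simp
      simp [hu]
    rw [h2]
    field_simp
    ring
  · have hAe : A 0 = -(1 / 2) := by
      have := hcl_eq 1 h1mem
      rw [sub_self] at this
      simp only [hA, this]
      norm_num
    rw [hD2 1 h1mem, sub_self, hw0, hP, volterraIntegrand, dslope_same,
      (hasDerivAt_comp_const_add_integral hg' hwc).deriv, hAe, hw0]
    simp
    ring

lemma exists_nonneg_potential {g : ℝ → ℝ} {b : ℝ} (hg : Continuous g)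
    (hodd : ∀ x, g (-x) = -g x) (hpos : ∀ x, 0 ≤ x → x ≤ b → 0 ≤ g x)
    (hneg : ∀ x, b ≤ x → g x ≤ 0) :
    ∃ G : ℝ → ℝ, (∀ x, HasDerivAt G (-g x) x) ∧ (∀ x, 0 ≤ G x) ∧ G b = 0 := by
  have hint : ∀ x y, IntervalIntegrable (fun t => -g t) MeasureTheory.volume x y := fun x y =>
    hg.neg.intervalIntegrable x y
  have hnn : ∀ x, 0 ≤ x → 0 ≤ ∫ t in b..x, -g t := by
    intro x hx
    rcases le_total b x with hbx | hbx
    · exact intervalIntegral.integral_nonneg hbx fun t ht => neg_nonneg.2 (hneg t ht.1)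
    · rw [intervalIntegral.integral_symm, intervalIntegral.integral_neg, neg_neg]
      exact intervalIntegral.integral_nonneg hbx fun t ht => hpos t (hx.trans ht.1) ht.2
  refine ⟨fun x => ∫ t in b..x, -g t, fun x => (hg.neg.integral_hasStrictDerivAt b x).hasDerivAt,
    fun x => ?_, intervalIntegral.integral_same⟩
  rcases le_total 0 x with hx | hx
  · exact hnn x hx
  · have h1 : ∫ t in (0 : ℝ)..x, -g t = ∫ t in (0 : ℝ)..(-x), -g t := by
      have := intervalIntegral.integral_comp_neg (a := 0) (b := x) (fun t => -g t)
      simp only [hodd, neg_neg, neg_zero] at this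
      rw [intervalIntegral.integral_symm (-x) 0, ← this, intervalIntegral.integral_neg]
    have h2 := hnn (-x) (by linarith)
    rw [← intervalIntegral.integral_add_adjacent_intervals (hint b 0) (hint 0 (-x)), ← h1,
      intervalIntegral.integral_add_adjacent_intervals (hint b 0) (hint 0 x)] at h2
    exact h2

lemma clamp_of_abs_le {M x : ℝ} (hx : |x| ≤ M) : max (-M) (min M x) = x := by
  rw [min_eq_right (abs_le.1 hx).2, max_eq_right (abs_le.1 hx).1]

lemma lipschitzWith_clamp (M : ℝ) : LipschitzWith 1 fun x : ℝ => max (-M) (min M x) :=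
  (LipschitzWith.id.const_min M).const_max (-M)

/-- The conditions on the nonlinearity under which solutions extend to `(0, 1]`. -/
structure IsConfining (f : ℝ → ℝ) (b f' : ℝ) : Prop where
  pos : 0 < b
  odd : ∀ x, f (-x) = -f x
  lipschitz : ∀ M : ℝ, ∃ L : NNReal, LipschitzOnWith L f (Icc (-M) M)
  hasDerivAt : HasDerivAt f f' b
  zero : f b = 0
  nonneg : ∀ x, 0 ≤ x → x ≤ b → 0 ≤ f x
  nonpos : ∀ x, b ≤ x → f x ≤ 0

namespace IsConfining

variable {f : ℝ → ℝ} {b f' : ℝ}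

/-- Truncating the nonlinearity above a level that the a priori bound keeps the solution below. -/
theorem exists_isRadialSolution (hf : IsConfining f b f') (k : ℕ) (a : ℝ) {c : ℝ} (hc : 0 < c)
    (hc1 : c < 1) : ∃ (ε : ℝ) (u : ℝ → ℝ), 0 < ε ∧ IsRadialSolution k f b a c (1 + ε) u ∧
      deriv (deriv u) 1 = -(k * a) - f' * a / 2 := by
  set S : ℝ := |a| / c ^ k with hS
  have hck : 0 < c ^ k := pow_pos hc k
  have hS0 : 0 ≤ S := by positivity
  have haS : |a| ≤ S := by
    rw [hS, le_div_iff₀ hck]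
    exact mul_le_of_le_one_right (abs_nonneg a) (pow_le_one₀ hc.le hc1.le)
  set M : ℝ := b + S + 1 with hM
  have hb := hf.pos
  have hM0 : 0 ≤ M := by positivity
  have hbM : b < M := by linarith
  obtain ⟨L, hL⟩ := hf.lipschitz M
  set g : ℝ → ℝ := fun x => f (max (-M) (min M x)) with hg
  have hgf : ∀ x, |x| ≤ M → g x = f x := fun x hx => by rw [hg]; simp only [clamp_of_abs_le hx]
  have hgL : LipschitzWith L g := by
    rw [← lipschitzOnWith_univ, ← mul_one L]
    exact hL.comp (lipschitzWith_clamp M).lipschitzOnWith fun x _ =>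
      ⟨le_max_left _ _, max_le (by linarith) (min_le_left _ _)⟩
  have hg' : HasDerivAt g f' b := by
    refine hf.hasDerivAt.congr_of_eventuallyEq ?_
    have : ∀ᶠ x in nhds b, |x| < M :=
      continuous_abs.continuousAt.eventually_lt continuousAt_const (by rwa [abs_of_pos hb])
    filter_upwards [this] with x hx using hgf x hx.le
  have hgb : g b = 0 := by rw [hgf b (by rw [abs_of_pos hb]; exact hbM.le), hf.zero]
  obtain ⟨G, hG, hG0, hGb⟩ := exists_nonneg_potential (g := g) (b := b) hgL.continuous
    (fun x => by
      simp only [hg]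
      rw [← hf.odd]
      congr 1
      simp only [max_def, min_def]
      split_ifs <;> linarith)
    (fun x hx0 hxb => by
      rw [hgf x (by rw [abs_of_nonneg hx0]; linarith)]
      exact hf.nonneg x hx0 hxb)
    (fun x hx => hf.nonpos _ (le_max_of_le_right (le_min hbM.le hx)))
  obtain ⟨u, hu, hu2⟩ := exists_isRadialSolution_of_lipschitz k a hc hc1 hgL hg' hgb
  have h1mem : (1 : ℝ) ∈ Ioo c 2 := ⟨hc1, by norm_num⟩
  have hslope : ∀ x ∈ Ioc c 1, ‖deriv u x‖ ≤ S := by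
    intro x hx
    rcases hx.2.eq_or_lt with rfl | hx1
    · rw [hu.deriv_one]
      exact haS
    · have h1 := hu.abs_pow_mul_deriv_le hc.le (by norm_num) hG hG0 hGb hgb ⟨hx.1, hx1⟩
      have hx0 : 0 < x := hc.trans hx.1
      rw [abs_mul, abs_of_pos (pow_pos hx0 k)] at h1
      rw [hS, le_div_iff₀ hck, mul_comm, Real.norm_eq_abs]
      refine le_trans ?_ h1
      gcongr
      exact hx.1.le
  have hleft : ∀ x ∈ Ioc c 1, |u x| ≤ M := by
    intro x hx
    have h1 := (convex_Ioc c 1).norm_image_sub_le_of_norm_deriv_le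
      (fun y hy => (hu.hasDerivAt ⟨hy.1, hy.2.trans_lt (by norm_num)⟩).differentiableAt) hslope
      (⟨hc1, le_rfl⟩ : (1 : ℝ) ∈ Ioc c 1) hx
    rw [hu.val_one, Real.norm_eq_abs, Real.norm_eq_abs, abs_sub_comm x 1,
      abs_of_nonneg (by linarith [hx.2] : 0 ≤ 1 - x)] at h1
    have h2 : S * (1 - x) ≤ S := mul_le_of_le_one_right hS0 (by linarith [hx.1])
    have h3 := abs_sub_abs_le_abs_sub (u x) b
    rw [abs_of_pos hb] at h3
    linarith
  have hnear : ∀ᶠ x in nhds 1, |u x| < M :=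
    (hu.hasDerivAt h1mem).continuousAt.abs.eventually_lt continuousAt_const (by
      rwa [hu.val_one, abs_of_pos hb])
  obtain ⟨ε, hε, hball⟩ := Metric.eventually_nhds_iff.1 hnear
  refine ⟨min ε 1, u, lt_min hε one_pos, ⟨hu.contDiffOn.mono (Ioo_subset_Ioo_right ?_),
    fun ρ hρ => ?_, hu.val_one, hu.deriv_one⟩, hu2⟩
  · linarith [min_le_right ε 1]
  · rw [hu.eqn ρ ⟨hρ.1, by linarith [hρ.2, min_le_right ε 1]⟩]
    refine hgf _ ?_
    rcases le_or_gt ρ 1 with h | h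
    · exact hleft ρ ⟨hρ.1, h⟩
    · refine (hball ?_).le
      rw [Real.dist_eq, abs_of_pos (by linarith)]
      linarith [hρ.2, min_le_left ε 1]

theorem exists_isRadialSolution_zero (hf : IsConfining f b f') (k : ℕ) (a : ℝ) :
    ∃ (ε : ℝ) (u : ℝ → ℝ), 0 < ε ∧ IsRadialSolution k f b a 0 (1 + ε) u ∧
      deriv (deriv u) 1 = -(k * a) - f' * a / 2 := by
  have hex : ∀ c : ℝ, ∃ (ε : ℝ) (u : ℝ → ℝ), 0 < c → c < 1 → 0 < ε ∧
      IsRadialSolution k f b a c (1 + ε) u ∧ deriv (deriv u) 1 = -(k * a) - f' * a / 2 := by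
    intro c
    by_cases h : 0 < c ∧ c < 1
    · obtain ⟨ε, u, hu⟩ := hf.exists_isRadialSolution k a h.1 h.2
      exact ⟨ε, u, fun _ _ => hu⟩
    · exact ⟨0, 0, fun h1 h2 => absurd ⟨h1, h2⟩ h⟩
  choose ε u hu using hex
  have huniq : ∀ c c', 0 < c → c < 1 → 0 < c' → c' < 1 → ∀ ρ, c < ρ → c' < ρ → ρ ≤ 1 →
      u c ρ = u c' ρ := by
    intro c c' hc hc1 hc' hc1' ρ h h' hρ
    obtain ⟨e1, s1, -⟩ := hu c hc hc1
    obtain ⟨e2, s2, -⟩ := hu c' hc' hc1'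
    have hmin : 1 < min (1 + ε c) (1 + ε c') := lt_min (by linarith) (by linarith)
    exact (s1.mono (le_max_left c c') (min_le_left _ (1 + ε c'))).eqOn
      (s2.mono (le_max_right c c') (min_le_right (1 + ε c) _)) (le_max_of_le_left hc.le)
      (max_lt hc1 hc1') hmin hf.lipschitz ⟨max_lt h h', hρ.trans_lt hmin⟩
  set U : ℝ → ℝ := fun ρ => u (min ρ 1 / 2) ρ with hU
  have hloc : ∀ ρ ∈ Ioo 0 (1 + ε (1 / 2)), U =ᶠ[nhds ρ] u (min ρ 1 / 2) ∧
      ρ ∈ Ioo (min ρ 1 / 2) (1 + ε (min ρ 1 / 2)) := by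
    intro ρ hρ
    rcases lt_or_ge ρ 1 with h | h
    · rw [min_eq_left h.le]
      have hρ0 := hρ.1
      obtain ⟨e, -, -⟩ := hu (ρ / 2) (by linarith) (by linarith)
      refine ⟨?_, by linarith, by linarith⟩
      filter_upwards [Ioo_mem_nhds (by linarith : ρ / 2 < ρ) h] with x hx
      simp only [hU]
      rw [min_eq_left hx.2.le]
      exact huniq _ _ (by linarith [hx.1]) (by linarith [hx.2]) (by linarith) (by linarith) x
        (by linarith [hx.1]) hx.1 hx.2.le
    · rw [min_eq_right h]
      refine ⟨?_, by linarith, hρ.2⟩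
      filter_upwards [Ioi_mem_nhds (by linarith : (1 : ℝ) / 2 < ρ)] with x hx
      simp only [mem_Ioi] at hx
      simp only [hU]
      rcases le_total x 1 with h' | h'
      · rw [min_eq_left h']
        exact huniq _ _ (by linarith) (by linarith) (by norm_num) (by norm_num) x
          (by linarith) hx h'
      · rw [min_eq_right h']
  have hmin : ∀ ρ : ℝ, 0 < ρ → 0 < min ρ 1 / 2 ∧ min ρ 1 / 2 < 1 := fun ρ hρ =>
    ⟨by positivity, by linarith [min_le_right ρ 1]⟩
  obtain ⟨he, h₁, h₁''⟩ := hu (1 / 2) (by norm_num) (by norm_num)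
  have hU1 := (hloc 1 ⟨one_pos, by linarith⟩).1
  rw [min_self] at hU1
  refine ⟨ε (1 / 2), U, he, ⟨fun ρ hρ => ?_, fun ρ hρ => ?_, ?_, ?_⟩, ?_⟩
  · obtain ⟨heq, hmem⟩ := hloc ρ hρ
    obtain ⟨-, hs, -⟩ := hu _ (hmin ρ hρ.1).1 (hmin ρ hρ.1).2
    exact ((hs.contDiffOn.contDiffAt (isOpen_Ioo.mem_nhds hmem)).congr_of_eventuallyEq
      heq).contDiffWithinAt
  · obtain ⟨heq, hmem⟩ := hloc ρ hρ
    obtain ⟨-, hs, -⟩ := hu _ (hmin ρ hρ.1).1 (hmin ρ hρ.1).2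
    rw [heq.deriv.deriv_eq, heq.deriv_eq, heq.eq_of_nhds]
    exact hs.eqn ρ hmem
  · rw [hU1.eq_of_nhds, h₁.val_one]
  · rw [hU1.deriv_eq, h₁.deriv_one]
  · rw [hU1.deriv.deriv_eq, h₁'']

end IsConfining

lemma hasDerivAt_abs_rpow_mul_self {q : ℝ} (hq : 0 < q) (x : ℝ) :
    HasDerivAt (fun x : ℝ => |x| ^ q * x) ((q + 1) * |x| ^ q) x := by
  have hne : ∀ y : ℝ, y ≠ 0 → HasDerivAt (fun x : ℝ => |x| ^ q * x) ((q + 1) * |y| ^ q) y := by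
    intro y hy
    have hy' : |y| ≠ 0 := abs_ne_zero.2 hy
    refine (((hasDerivAt_abs hy).rpow_const (p := q) (Or.inl hy')).mul
      (hasDerivAt_id y)).congr_deriv ?_
    simp only [id]
    have h1 : |y| ^ (q - 1) * |y| = |y| ^ q := by
      rw [Real.rpow_sub_one hy']
      field_simp
    have h2 : (SignType.sign y : ℝ) * y = |y| := sign_mul_self y
    linear_combination (q * |y| ^ (q - 1)) * h2 + q * h1
  rcases eq_or_ne x 0 with rfl | hx
  · have hc : Continuous fun x : ℝ => |x| ^ q :=
      continuous_abs.rpow_const fun _ => Or.inr hq.le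
    exact hasDerivAt_of_hasDerivAt_of_ne (g := fun y : ℝ => (q + 1) * |y| ^ q) hne
      (hc.mul continuous_id).continuousAt (continuous_const.mul hc).continuousAt
  · exact hne x hx

lemma isConfining_power {q b : ℝ} (hq : 0 < q) (hb : 0 < b) :
    IsConfining (fun x => b ^ q * x - |x| ^ q * x) b (-(q * b ^ q)) := by
  have hd : ∀ x, HasDerivAt (fun x => b ^ q * x - |x| ^ q * x)
      (b ^ q - (q + 1) * |x| ^ q) x := fun x =>
    (((hasDerivAt_id x).const_mul (b ^ q)).sub
      (hasDerivAt_abs_rpow_mul_self hq x)).congr_deriv (by simp)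
  refine ⟨hb, fun x => by rw [abs_neg]; ring, fun M => ?_, ?_, ?_, fun x hx hxb => ?_,
    fun x hx => ?_⟩
  · refine (contDiff_one_iff_deriv.2 ⟨fun x => (hd x).differentiableAt, ?_⟩).contDiffOn
      |>.exists_lipschitzOnWith one_ne_zero (convex_Icc _ _) isCompact_Icc
    rw [funext fun x => (hd x).deriv]
    exact continuous_const.sub (continuous_const.mul
      (continuous_abs.rpow_const fun _ => Or.inr hq.le))
  · refine (hd b).congr_deriv ?_
    rw [abs_of_pos hb]
    ring
  · simp [abs_of_pos hb]
  · rw [abs_of_nonneg hx, ← sub_mul]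
    exact mul_nonneg (sub_nonneg.2 (Real.rpow_le_rpow hx hxb hq.le)) hx
  · have hx0 : 0 ≤ x := hb.le.trans hx
    rw [abs_of_nonneg hx0, ← sub_mul]
    exact mul_nonpos_of_nonpos_of_nonneg
      (sub_nonpos.2 (Real.rpow_le_rpow hb.le hx hq.le)) hx0

theorem stmt12 (N : ℕ) (p : ℝ) (hN : 4 ≤ N) (hp : p = 1 + 4 / ((N : ℝ) - 3)) :
    ∀ a : ℝ,
      ∃ (U : ℝ → ℝ) (ε : ℝ), 0 < ε ∧
        -- `U` is a `C²` solution near `ρ = 1`, extended to `(0,1]`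
        ContDiffOn ℝ 2 U (Ioo 0 (1 + ε)) ∧
        IsSolOn N p U (Ioo 0 (1 + ε)) ∧
        U 1 = b0 p ∧
        deriv U 1 = a ∧
        deriv (deriv U) 1 = -(((N : ℝ) - 1) / 2) * a ∧
        -- uniqueness near `ρ = 1`
        (∀ (V : ℝ → ℝ) (δ : ℝ), 0 < δ →
          ContDiffOn ℝ 2 V (Ioo (1 - δ) (1 + δ)) →
          IsSolOn N p V (Ioo (1 - δ) (1 + δ)) →
          V 1 = b0 p → deriv V 1 = a →
          ∃ η > 0, EqOn V U (Ioo (1 - η) (1 + η))) := by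
  intro a
  have hN' : (4 : ℝ) ≤ N := by exact_mod_cast hN
  have hN3 : (0 : ℝ) < N - 3 := by linarith
  have hq : p - 1 = 4 / ((N : ℝ) - 3) := by rw [hp]; ring
  have hq0 : 0 < p - 1 := by rw [hq]; positivity
  have hα : alphaP p = ((N : ℝ) - 3) / 2 := by
    rw [alphaP, hq]
    field_simp
    norm_num
  have hκ : 2 * (p + 1) / (p - 1) ^ 2 = alphaP p * (alphaP p + 1) := by
    rw [alphaP]
    field_simp
    ring
  have hκ0 : 0 < alphaP p * (alphaP p + 1) := by rw [hα]; positivity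
  have hb0 : 0 < b0 p := by
    rw [b0, hκ]
    exact Real.rpow_pos_of_pos hκ0 _
  have hbq : b0 p ^ (p - 1) = alphaP p * (alphaP p + 1) := by
    rw [b0, hκ, ← Real.rpow_mul hκ0.le, one_div_mul_cancel hq0.ne', Real.rpow_one]
  have hk : ((N - 1 : ℕ) : ℝ) = (N : ℝ) - 1 := by
    rw [Nat.cast_sub (by omega), Nat.cast_one]
  have hconf := isConfining_power hq0 hb0
  have heqn : ∀ (u : ℝ → ℝ) (ρ : ℝ), 0 < ρ →
      ((1 - ρ ^ 2) * (deriv (deriv u) ρ + ((N - 1 : ℕ) : ℝ) / ρ * deriv u ρ)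
          = b0 p ^ (p - 1) * u ρ - |u ρ| ^ (p - 1) * u ρ ↔
        (1 - ρ ^ 2) * deriv (deriv u) ρ
          + (((N : ℝ) - 1) / ρ - 2 * (alphaP p + 1) * ρ) * deriv u ρ
          - alphaP p * (alphaP p + 1) * u ρ + |u ρ| ^ (p - 1) * u ρ = 0) := by
    intro u ρ hρ
    rw [hbq, hk, show 2 * (alphaP p + 1) = (N : ℝ) - 1 by rw [hα]; ring,
      show (1 - ρ ^ 2) * (deriv (deriv u) ρ + ((N : ℝ) - 1) / ρ * deriv u ρ)
        = (1 - ρ ^ 2) * deriv (deriv u) ρ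
          + (((N : ℝ) - 1) / ρ - ((N : ℝ) - 1) * ρ) * deriv u ρ by field_simp]
    constructor <;> intro h <;> linarith
  obtain ⟨ε, U, hε, hU, hU''⟩ := hconf.exists_isRadialSolution_zero (N - 1) a
  refine ⟨U, ε, hε, hU.contDiffOn, fun ρ hρ => (heqn U ρ hρ.1).1 (hU.eqn ρ hρ), hU.val_one,
    hU.deriv_one, ?_, fun V δ hδ hV hVs hV1 hV1' => ?_⟩
  · have hqα : (p - 1) * alphaP p = 2 := by
      rw [alphaP]
      field_simp
    have h1 : (p - 1) * b0 p ^ (p - 1) = (N : ℝ) - 1 := by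
      rw [hbq, ← mul_assoc, hqα, hα]
      ring
    rw [hU'', h1, hk]
    ring
  · have hη : 0 < min (min δ ε) 1 := by positivity
    have hηδ : min (min δ ε) 1 ≤ δ := (min_le_left _ _).trans (min_le_left _ _)
    have hηε : min (min δ ε) 1 ≤ ε := (min_le_left _ _).trans (min_le_right _ _)
    have hη1 : min (min δ ε) 1 ≤ 1 := min_le_right _ _
    refine ⟨min (min δ ε) 1, hη, ?_⟩
    have hsub : Ioo (1 - min (min δ ε) 1) (1 + min (min δ ε) 1) ⊆ Ioo (1 - δ) (1 + δ) :=
      Ioo_subset_Ioo (by linarith) (by linarith)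
    have hVsol : IsRadialSolution (N - 1) (fun x => b0 p ^ (p - 1) * x - |x| ^ (p - 1) * x)
        (b0 p) a (1 - min (min δ ε) 1) (1 + min (min δ ε) 1) V :=
      ⟨hV.mono hsub, fun ρ hρ => (heqn V ρ (by linarith [hρ.1])).2 (hVs ρ (hsub hρ)), hV1, hV1'⟩
    exact hVsol.eqOn (hU.mono (by linarith) (by linarith)) (by linarith) (by linarith)
      (by linarith) hconf.lipschitz
end

section
/- Assume N ≥ 4 and p = 1 + 4/(N−3). Let c ∈ ℝ and suppose that u(1,c) = b₀ (where u(1,c) denotes the continuous extension of u(·,c) to ρ = 1). Then the limit a := lim_{ρ→1⁻} u′(ρ,c) exists in ℝ, and u(ρ,c) = U(ρ,a) for ρ < 1 near 1; in particular u(·,c) extends to a C² solution of (PDE) on a neighborhood of ρ = 1. -/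
open Set Filter

theorem exists_fixedPoint_integral (a : ℝ) (Φ : BoundedContinuousFunction ℝ ℝ → ℝ → ℝ) (M : ℝ)
    (hcont : ∀ y, Continuous (Φ y))
    (hlip : ∀ y₁ y₂ s, |Φ y₁ s - Φ y₂ s| ≤ M * dist y₁ y₂) :
    ∃ ε > 0, ε < 1 / 2 ∧ ∃ y : BoundedContinuousFunction ℝ ℝ,
      ∀ s ∈ Icc (-ε) ε, y s = a + ∫ σ in (0 : ℝ)..s, Φ y σ := by
  set ε : ℝ := 1 / (4 * (|M| + 1)) with hε
  have hM : 0 < |M| + 1 := by positivity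
  have hε0 : 0 < ε := by positivity
  have hε1 : ε < 1 / 2 := by
    rw [hε, div_lt_div_iff₀ (by positivity) (by norm_num)]
    linarith [abs_nonneg M]
  have hεM : M * ε ≤ 1 / 2 := by
    have h1 : (|M| + 1) * ε = 1 / 4 := by rw [hε]; field_simp
    nlinarith [le_abs_self M]
  set k : ℝ → ℝ := fun s => max (-ε) (min ε s) with hk
  have hkc : Continuous k := by fun_prop
  have hkm : ∀ s, k s ∈ Icc (-ε) ε := fun s =>
    ⟨le_max_left _ _, max_le (by linarith) (min_le_left _ _)⟩
  have hkid : ∀ s ∈ Icc (-ε) ε, k s = s := fun s hs => by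
    simp only [hk]; rw [min_eq_right hs.2, max_eq_right hs.1]
  have hprim : ∀ y, Continuous fun s => ∫ σ in (0 : ℝ)..s, Φ y σ := fun y =>
    intervalIntegral.continuous_primitive (fun _ _ => (hcont y).intervalIntegrable _ _) 0
  have hTc : ∀ y, Continuous fun s => a + ∫ σ in (0 : ℝ)..k s, Φ y σ := fun y =>
    continuous_const.add ((hprim y).comp hkc)
  have hTb : ∀ y, ∃ C, ∀ s, ‖a + ∫ σ in (0 : ℝ)..k s, Φ y σ‖ ≤ C := fun y => by
    obtain ⟨C, hC⟩ := isCompact_Icc.exists_bound_of_continuousOn (s := Icc (-ε) ε)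
      (continuous_const.add (hprim y) : Continuous fun s => a + ∫ σ in (0 : ℝ)..s, Φ y σ).continuousOn
    exact ⟨C, fun s => hC _ (hkm s)⟩
  choose C hC using hTb
  let T : BoundedContinuousFunction ℝ ℝ → BoundedContinuousFunction ℝ ℝ := fun y =>
    BoundedContinuousFunction.ofNormedAddCommGroup _ (hTc y) (C y) (hC y)
  have hT : ContractingWith (1 / 2) T := by
    refine ⟨by rw [← NNReal.coe_lt_coe]; norm_num, LipschitzWith.of_dist_le_mul fun y₁ y₂ => ?_⟩
    have hd : 0 ≤ dist y₁ y₂ := dist_nonneg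
    refine (BoundedContinuousFunction.dist_le (by positivity)).2 fun s => ?_
    have hM0 : 0 ≤ M * dist y₁ y₂ := (abs_nonneg _).trans (hlip y₁ y₂ 0)
    change dist (a + ∫ σ in (0 : ℝ)..k s, Φ y₁ σ) (a + ∫ σ in (0 : ℝ)..k s, Φ y₂ σ) ≤ _
    rw [dist_add_left, dist_eq_norm, ← intervalIntegral.integral_sub
      ((hcont y₁).intervalIntegrable _ _) ((hcont y₂).intervalIntegrable _ _)]
    refine (intervalIntegral.norm_integral_le_of_norm_le_const
      (C := M * dist y₁ y₂) fun σ _ => hlip y₁ y₂ σ).trans ?_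
    have : |k s - 0| ≤ ε := by rw [sub_zero]; exact abs_le.2 (hkm s)
    calc M * dist y₁ y₂ * |k s - 0| ≤ M * dist y₁ y₂ * ε := by gcongr
      _ = (M * ε) * dist y₁ y₂ := by ring
      _ ≤ (1 / 2) * dist y₁ y₂ := by gcongr
      _ = _ := by simp
  refine ⟨ε, hε0, hε1, ContractingWith.fixedPoint T hT, fun s hs => ?_⟩
  have h := congrArg (fun y : BoundedContinuousFunction ℝ ℝ => y s) hT.fixedPoint_isFixedPt.eq
  conv_lhs => rw [← h]
  change a + ∫ σ in (0 : ℝ)..k s, _ = _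
  rw [hkid s hs]

theorem abs_sub_le_of_abs_deriv_le {q q' B B' : ℝ → ℝ} {x y : ℝ} (hxy : x ≤ y)
    (hq : ContinuousOn q (Icc x y)) (hB : ContinuousOn B (Icc x y))
    (hq' : ∀ r ∈ Ioo x y, HasDerivAt q (q' r) r) (hB' : ∀ r ∈ Ioo x y, HasDerivAt B (B' r) r)
    (hle : ∀ r ∈ Ioo x y, |q' r| ≤ B' r) : |q y - q x| ≤ B y - B x := by
  have hx := left_mem_Icc.2 hxy
  have hy := right_mem_Icc.2 hxy
  have h₁ : MonotoneOn (B - q) (Icc x y) := by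
    refine monotoneOn_of_hasDerivWithinAt_nonneg (f' := fun r => B' r - q' r)
      (convex_Icc x y) (hB.sub hq) (fun r hr => ?_) (fun r hr => ?_) <;>
      rw [interior_Icc] at hr
    · exact ((hB' r hr).sub (hq' r hr)).hasDerivWithinAt
    · linarith [(abs_le.1 (hle r hr)).2]
  have h₂ : MonotoneOn (B + q) (Icc x y) := by
    refine monotoneOn_of_hasDerivWithinAt_nonneg (f' := fun r => B' r + q' r)
      (convex_Icc x y) (hB.add hq) (fun r hr => ?_) (fun r hr => ?_) <;>
      rw [interior_Icc] at hr
    · exact ((hB' r hr).add (hq' r hr)).hasDerivWithinAt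
    · linarith [(abs_le.1 (hle r hr)).1]
  have h₁ := h₁ hx hy hxy
  have h₂ := h₂ hx hy hxy
  simp only [Pi.sub_apply, Pi.add_apply] at h₁ h₂
  exact abs_le.2 ⟨by linarith, by linarith⟩

/-- Uniqueness for a second order linear differential inequality with a simple pole at `1`. -/
theorem eq_zero_of_abs_deriv_le {d D E : ℝ → ℝ} {A B τ : ℝ} (hA : 0 ≤ A) (hB : 0 ≤ B)
    (hτ : 0 < τ) (hsmall : (A + B) * τ < 1)
    (hd : ContinuousOn d (Icc (1 - τ) 1)) (hD : ContinuousOn D (Icc (1 - τ) 1))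
    (hd' : ∀ r ∈ Ioo (1 - τ) 1, HasDerivAt d (D r) r)
    (hD' : ∀ r ∈ Ioo (1 - τ) 1, HasDerivAt D (E r) r)
    (hd1 : d 1 = 0) (hD1 : D 1 = 0)
    (hE : ∀ r ∈ Ioo (1 - τ) 1, |E r| ≤ A * |D r| + B * (|d r| / (1 - r))) :
    ∀ r ∈ Icc (1 - τ) 1, d r = 0 := by
  obtain ⟨r₀, hr₀, hmax⟩ := isCompact_Icc.exists_isMaxOn
    (nonempty_Icc.2 (by linarith : 1 - τ ≤ 1)) hD.abs
  set M := |D r₀| with hM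
  have hM0 : 0 ≤ M := abs_nonneg _
  have hDM : ∀ r ∈ Icc (1 - τ) 1, |D r| ≤ M := fun r hr => hmax hr
  have hdM : ∀ r ∈ Icc (1 - τ) 1, |d r| ≤ M * (1 - r) := fun r hr => by
    have hs : Icc r 1 ⊆ Icc (1 - τ) 1 := Icc_subset_Icc_left hr.1
    have hs' : Ioo r 1 ⊆ Ioo (1 - τ) 1 := Ioo_subset_Ioo_left hr.1
    have := abs_sub_le_of_abs_deriv_le (B := fun s => M * s) (B' := fun _ => M) hr.2 (hd.mono hs)
      (by fun_prop) (fun s hs₁ => hd' s (hs' hs₁))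
      (fun s _ => by simpa using (hasDerivAt_id s).const_mul M)
      (fun s hs₁ => hDM s (hs (Ioo_subset_Icc_self hs₁)))
    rw [hd1, zero_sub, abs_neg] at this
    linarith
  have hEM : ∀ r ∈ Ioo (1 - τ) 1, |E r| ≤ (A + B) * M := fun r hr => by
    have hr' := Ioo_subset_Icc_self hr
    have h1 : 0 < 1 - r := by linarith [hr.2]
    have : |d r| / (1 - r) ≤ M := by rw [div_le_iff₀ h1]; exact hdM r hr'
    have := mul_le_mul_of_nonneg_left this hB
    have := mul_le_mul_of_nonneg_left (hDM r hr') hA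
    linarith [hE r hr]
  have hr₀M : M ≤ (A + B) * M * (1 - r₀) := by
    have hs : Icc r₀ 1 ⊆ Icc (1 - τ) 1 := Icc_subset_Icc_left hr₀.1
    have hs' : Ioo r₀ 1 ⊆ Ioo (1 - τ) 1 := Ioo_subset_Ioo_left hr₀.1
    have := abs_sub_le_of_abs_deriv_le (B := fun s => (A + B) * M * s)
      (B' := fun _ => (A + B) * M) hr₀.2 (hD.mono hs)
      (by fun_prop) (fun s hs₁ => hD' s (hs' hs₁))
      (fun s _ => by simpa using (hasDerivAt_id s).const_mul ((A + B) * M))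
      (fun s hs₁ => hEM s (hs' hs₁))
    rw [hD1, zero_sub, abs_neg] at this
    linarith
  have hMz : M = 0 := by
    have : (A + B) * M * (1 - r₀) ≤ (A + B) * M * τ := by
      gcongr; linarith [hr₀.1]
    nlinarith
  intro r hr
  have := hdM r hr
  rw [hMz, zero_mul] at this
  exact abs_nonpos_iff.1 this

theorem exists_contDiffOn_solution (n a b : ℝ) {g : ℝ → ℝ} {K : NNReal} (hg : LipschitzWith K g)
    (hgb : g b = 0) (hgd : DifferentiableAt ℝ g b) :
    ∃ (W : ℝ → ℝ) (ε : ℝ), 0 < ε ∧ ε < 1 / 2 ∧ ContDiffOn ℝ 2 W (Ioo (1 - ε) (1 + ε)) ∧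
      W 1 = b ∧ deriv W 1 = a ∧
      ∀ ρ ∈ Ioo (1 - ε) (1 + ε),
        (1 - ρ ^ 2) * deriv (deriv W) ρ + n * (1 / ρ - ρ) * deriv W ρ + g (W ρ) = 0 := by
  set G : ℝ → ℝ := fun x => g (b + x) with hG
  have hG0 : G 0 = 0 := by simp [hG, hgb]
  have hGl : ∀ x₁ x₂, |G x₁ - G x₂| ≤ K * |x₁ - x₂| := fun x₁ x₂ => by
    have := hg.dist_le_mul (b + x₁) (b + x₂)
    rwa [dist_add_left, Real.dist_eq, Real.dist_eq] at this
  have hGd : DifferentiableAt ℝ G 0 := by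
    have : DifferentiableAt ℝ g (b + 0) := by simpa using hgd
    exact this.comp (0 : ℝ) (by fun_prop : DifferentiableAt ℝ (fun x => b + x) 0)
  have hGc : Continuous G := hg.continuous.comp (by fun_prop)
  set S : ℝ → ℝ := dslope G 0 with hS
  have hSc : Continuous S := continuous_iff_continuousAt.2 fun x => by
    rcases eq_or_ne x 0 with rfl | hx
    · exact continuousAt_dslope_same.2 hGd
    · exact (continuousAt_dslope_of_ne hx).2 hGc.continuousAt
  have hSG : ∀ x, x * S x = G x := fun x => by
    have := sub_smul_dslope G 0 x
    simpa [hG0] using this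
  have hSlip₀ : ∀ σ z₁ z₂, σ ≠ 0 → |z₁ * S (σ * z₁) - z₂ * S (σ * z₂)| ≤ K * |z₁ - z₂| :=
    fun σ z₁ z₂ hσ => by
      have h := hGl (σ * z₁) (σ * z₂)
      rw [← hSG, ← hSG, mul_assoc, mul_assoc, ← mul_sub, ← mul_sub, abs_mul, abs_mul] at h
      have hσ' : 0 < |σ| := abs_pos.2 hσ
      nlinarith
  have hSlip : ∀ σ z₁ z₂, |z₁ * S (σ * z₁) - z₂ * S (σ * z₂)| ≤ K * |z₁ - z₂| :=
    fun σ z₁ z₂ => by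
      have hcl : IsClosed {σ | |z₁ * S (σ * z₁) - z₂ * S (σ * z₂)| ≤ K * |z₁ - z₂|} :=
        isClosed_le (by fun_prop) continuous_const
      have hd : Dense {σ : ℝ | |z₁ * S (σ * z₁) - z₂ * S (σ * z₂)| ≤ K * |z₁ - z₂|} :=
        (dense_compl_singleton (0 : ℝ)).mono fun σ hσ => hSlip₀ σ z₁ z₂ hσ
      exact (hcl.closure_eq ▸ hd.closure_eq ▸ mem_univ σ :)
  set z : BoundedContinuousFunction ℝ ℝ → ℝ → ℝ :=
    fun y σ => ∫ t in (0 : ℝ)..1, y (σ * t) with hz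
  have hzc : ∀ y, Continuous (z y) := fun y =>
    intervalIntegral.continuous_parametric_intervalIntegral_of_continuous' (by
      have := y.continuous
      fun_prop) 0 1
  have hzl : ∀ y₁ y₂ σ, |z y₁ σ - z y₂ σ| ≤ dist y₁ y₂ := fun y₁ y₂ σ => by
    have h₁ := y₁.continuous
    have h₂ := y₂.continuous
    simp only [hz]
    rw [← intervalIntegral.integral_sub (Continuous.intervalIntegrable (by fun_prop) _ _)
      (Continuous.intervalIntegrable (by fun_prop) _ _)]
    have h₃ : ∀ t, ‖y₁ (σ * t) - y₂ (σ * t)‖ ≤ dist y₁ y₂ := fun t =>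
      BoundedContinuousFunction.dist_coe_le_dist (f := y₁) (g := y₂) (σ * t)
    simpa using intervalIntegral.norm_integral_le_of_norm_le_const (a := 0) (b := 1)
      fun t _ => h₃ t
  have hzs : ∀ y : BoundedContinuousFunction ℝ ℝ, ∀ σ, σ * z y σ = ∫ t in (0 : ℝ)..σ, y t :=
    fun y σ => by
      have := intervalIntegral.smul_integral_comp_mul_left (a := 0) (b := 1) (fun t => y t) σ
      rwa [smul_eq_mul, mul_zero, mul_one] at this
  set Φ : BoundedContinuousFunction ℝ ℝ → ℝ → ℝ := fun y σ =>
    -n / max (1 / 2) (1 + σ) * y σ + 1 / max 1 (2 + σ) * (z y σ * S (σ * z y σ)) with hΦ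
  have hpos₁ : ∀ σ : ℝ, 0 < max (1 / 2) (1 + σ) := fun σ => lt_max_of_lt_left (by norm_num)
  have hpos₂ : ∀ σ : ℝ, 0 < max 1 (2 + σ) := fun σ => lt_max_of_lt_left (by norm_num)
  have hΦc : ∀ y, Continuous (Φ y) := fun y => by
    have h₁ := y.continuous
    have h₂ := hzc y
    refine ((continuous_const.div (by fun_prop) fun σ => (hpos₁ σ).ne').mul h₁).add
      ((continuous_const.div (by fun_prop) fun σ => (hpos₂ σ).ne').mul ?_)
    fun_prop
  have hΦl : ∀ y₁ y₂ s, |Φ y₁ s - Φ y₂ s| ≤ (2 * |n| + K) * dist y₁ y₂ := fun y₁ y₂ s => by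
    have h₁ : |-n / max (1 / 2) (1 + s)| ≤ 2 * |n| := by
      rw [abs_div, abs_neg, abs_of_pos (hpos₁ s), div_le_iff₀ (hpos₁ s)]
      have : 1 / 2 ≤ max (1 / 2) (1 + s) := le_max_left _ _
      nlinarith [abs_nonneg n]
    have h₂ : |1 / max 1 (2 + s)| ≤ 1 := by
      rw [abs_div, abs_one, abs_of_pos (hpos₂ s), div_le_iff₀ (hpos₂ s), one_mul]
      exact le_max_left _ _
    have h₃ : |y₁ s - y₂ s| ≤ dist y₁ y₂ :=
      BoundedContinuousFunction.dist_coe_le_dist (f := y₁) (g := y₂) s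
    have h₄ : |z y₁ s * S (s * z y₁ s) - z y₂ s * S (s * z y₂ s)| ≤ K * dist y₁ y₂ :=
      (hSlip _ _ _).trans (by gcongr; exact hzl _ _ _)
    calc |Φ y₁ s - Φ y₂ s|
        = |-n / max (1 / 2) (1 + s) * (y₁ s - y₂ s) + 1 / max 1 (2 + s) *
            (z y₁ s * S (s * z y₁ s) - z y₂ s * S (s * z y₂ s))| := by
          simp only [hΦ]; congr 1; ring
      _ ≤ |-n / max (1 / 2) (1 + s)| * |y₁ s - y₂ s| + |1 / max 1 (2 + s)| *
            |z y₁ s * S (s * z y₁ s) - z y₂ s * S (s * z y₂ s)| := by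
          rw [← abs_mul, ← abs_mul]; exact abs_add_le _ _
      _ ≤ 2 * |n| * dist y₁ y₂ + 1 * (K * dist y₁ y₂) := by gcongr
      _ = _ := by ring
  obtain ⟨ε, hε, hε', y, hy⟩ := exists_fixedPoint_integral a Φ _ hΦc hΦl
  have hyc := y.continuous
  set W : ℝ → ℝ := fun ρ => b + ∫ t in (0 : ℝ)..(ρ - 1), y t with hW
  have hW' : ∀ ρ, HasDerivAt W (y (ρ - 1)) ρ := fun ρ => by
    have h := (hyc.integral_hasStrictDerivAt 0 (ρ - 1)).hasDerivAt.comp ρ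
      ((hasDerivAt_id ρ).sub_const 1)
    rw [mul_one] at h
    exact h.const_add b
  have hdW : deriv W = fun ρ => y (ρ - 1) := funext fun ρ => (hW' ρ).deriv
  have hW'' : ∀ ρ ∈ Ioo (1 - ε) (1 + ε), HasDerivAt (deriv W) (Φ y (ρ - 1)) ρ := fun ρ hρ => by
    have h := (((hΦc y).integral_hasStrictDerivAt 0 (ρ - 1)).hasDerivAt.comp ρ
      ((hasDerivAt_id ρ).sub_const 1)).const_add a
    rw [mul_one] at h
    refine h.congr_of_eventuallyEq ?_
    filter_upwards [Ioo_mem_nhds hρ.1 hρ.2] with r hr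
    rw [hdW]
    exact hy _ ⟨by linarith [hr.1], by linarith [hr.2]⟩
  refine ⟨W, ε, hε, hε', ?_, by simp [hW], ?_, fun ρ hρ => ?_⟩
  · have hopen : IsOpen (Ioo (1 - ε) (1 + ε)) := isOpen_Ioo
    have h1 : ContDiffOn ℝ 1 (deriv W) (Ioo (1 - ε) (1 + ε)) := by
      rw [show (1 : WithTop ℕ∞) = 0 + 1 by simp, contDiffOn_succ_iff_deriv_of_isOpen hopen]
      refine ⟨fun ρ hρ => (hW'' ρ hρ).differentiableAt.differentiableWithinAt, by simp, ?_⟩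
      rw [contDiffOn_zero]
      refine ContinuousOn.congr (f := fun ρ => Φ y (ρ - 1)) ?_ fun ρ hρ => (hW'' ρ hρ).deriv
      exact ((hΦc y).comp (by fun_prop)).continuousOn
    rw [show (2 : WithTop ℕ∞) = 1 + 1 by norm_num, contDiffOn_succ_iff_deriv_of_isOpen hopen]
    exact ⟨fun ρ _ => (hW' ρ).differentiableAt.differentiableWithinAt, by simp, h1⟩
  · rw [hdW]
    have := hy 0 ⟨by linarith, by linarith⟩
    simpa using this
  · rw [(hW'' ρ hρ).deriv, hdW]
    have hWG : g (W ρ) = (ρ - 1) * (z y (ρ - 1) * S ((ρ - 1) * z y (ρ - 1))) := by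
      rw [← mul_assoc, hSG, hG, hzs]
    rw [hWG]
    simp only [hΦ]
    rw [max_eq_right (by linarith [hρ.1] : (1 / 2 : ℝ) ≤ 1 + (ρ - 1)),
      max_eq_right (by linarith [hρ.1] : (1 : ℝ) ≤ 2 + (ρ - 1))]
    have h₁ : (1 + (ρ - 1) : ℝ) ≠ 0 := by linarith [hρ.1]
    have h₂ : (2 + (ρ - 1) : ℝ) ≠ 0 := by linarith [hρ.1]
    have h₃ : ρ ≠ 0 := by linarith [hρ.1]
    have h₄ : (1 + ρ) ≠ 0 := by linarith [hρ.1]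
    rw [show (1 + (ρ - 1) : ℝ) = ρ by ring, show (2 + (ρ - 1) : ℝ) = 1 + ρ by ring]
    field_simp
    ring

/-- A solution tending to a zero of the nonlinearity at the singular point has a finite slope
there. -/
theorem exists_tendsto_deriv {n : ℕ} {b L τ : ℝ} {v v' v'' f : ℝ → ℝ} (hτ : 0 < τ)
    (hτ' : τ ≤ 1 / 2) (hL : 0 ≤ L) (hv : ContinuousOn v (Icc (1 - τ) 1)) (hv1 : v 1 = b)
    (hv' : ∀ r ∈ Ioo (1 - τ) 1, HasDerivAt v (v' r) r)
    (hv'' : ∀ r ∈ Ioo (1 - τ) 1, HasDerivAt v' (v'' r) r)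
    (hf : ∀ r ∈ Ioo (1 - τ) 1, |f r| ≤ L * |v r - b|)
    (heq : ∀ r ∈ Ioo (1 - τ) 1, (1 - r ^ 2) * v'' r + n * (1 / r - r) * v' r + f r = 0) :
    ∃ a, Tendsto v' (nhdsWithin 1 (Iio 1)) (nhds a) := by
  set q : ℝ → ℝ := fun r => r ^ n * v' r with hq
  set q' : ℝ → ℝ := fun r => -(r ^ n * f r / (1 - r ^ 2)) with hq'
  have hqd : ∀ r ∈ Ioo (1 - τ) 1, HasDerivAt q (q' r) r := fun r hr => by
    have h := (hasDerivAt_pow n r).mul (hv'' r hr)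
    refine h.congr_deriv ?_
    have hr0 : r ≠ 0 := by linarith [hr.1]
    have hr2 : 1 - r ^ 2 ≠ 0 := by nlinarith [hr.1, hr.2]
    have hf' : f r = -((1 - r ^ 2) * v'' r + n * (1 / r - r) * v' r) := by linarith [heq r hr]
    have hpow : (n : ℝ) * r ^ (n - 1) = n * r ^ n / r := by
      rcases n with _ | n
      · simp
      · rw [Nat.add_sub_cancel, pow_succ]; field_simp
    simp only [hq']
    rw [hf', hpow]
    field_simp
    ring
  have hqb : ∀ r ∈ Ioo (1 - τ) 1, |q' r| ≤ L * |v r - b| / (1 - r) := fun r hr => by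
    have hr0 : 0 < r := by linarith [hr.1]
    have hr1 : 0 < 1 - r := by linarith [hr.2]
    have hr2 : 1 - r ≤ 1 - r ^ 2 := by nlinarith
    simp only [hq']
    rw [abs_neg, abs_div, abs_mul, abs_of_pos (by linarith : 0 < 1 - r ^ 2),
      abs_of_pos (pow_pos hr0 n)]
    have : r ^ n ≤ 1 := pow_le_one₀ hr0.le hr.2.le
    have := hf r hr
    calc r ^ n * |f r| / (1 - r ^ 2) ≤ 1 * (L * |v r - b|) / (1 - r) := by gcongr
      _ = _ := by rw [one_mul]
  have hsqrt : ∀ r < 1, HasDerivAt (fun s : ℝ => √(1 - s)) (-(1 / (2 * √(1 - r)))) r :=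
    fun r hr => by
      have h := ((hasDerivAt_id r).const_sub 1).sqrt (by simp; linarith)
      simpa [neg_div] using h
  have hsq : ∀ r < 1, 0 < √(1 - r) := fun r hr => Real.sqrt_pos.2 (by linarith)
  have hss : ∀ r < 1, √(1 - r) * √(1 - r) = 1 - r := fun r hr =>
    Real.mul_self_sqrt (by linarith)
  have hs1 : ∀ r ∈ Ioo (1 - τ) 1, √(1 - r) ≤ 1 := fun r hr =>
    Real.sqrt_le_one.2 (by linarith [hr.1])
  obtain ⟨C₀, hC₀⟩ := isCompact_Icc.exists_bound_of_continuousOn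
    (hv.sub continuousOn_const : ContinuousOn (fun r => v r - b) (Icc (1 - τ) 1))
  have hC₀n : 0 ≤ C₀ := (norm_nonneg _).trans (hC₀ 1 ⟨by linarith, le_rfl⟩)
  set x₀ : ℝ := 1 - τ / 2 with hx₀
  have hx₀1 : x₀ < 1 := by linarith
  have hsub : ∀ {x y}, x₀ ≤ x → y < 1 → Icc x y ⊆ Ioo (1 - τ) 1 := fun hx hy r hr =>
    ⟨by linarith [hr.1], by linarith [hr.2]⟩
  have hqc : ∀ {x y}, x₀ ≤ x → y < 1 → ContinuousOn q (Icc x y) := fun hx hy r hr =>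
    (hqd r (hsub hx hy hr)).continuousAt.continuousWithinAt
  -- The crude bound on `q'` only gives growth of order `(1 - r) ^ (-1 / 2)`.
  set C₁ : ℝ := |q x₀| + 2 * (L * C₀) with hC₁
  have hqgrow : ∀ r ∈ Ico x₀ 1, |q r| ≤ C₁ / √(1 - r) := fun r hr => by
    have hB : ∀ s < 1, HasDerivAt (fun s : ℝ => 2 * (L * C₀) * (√(1 - s))⁻¹)
        (L * C₀ / ((1 - s) * √(1 - s))) s := fun s hs => by
      have h := ((hsqrt s hs).inv (hsq s hs).ne').const_mul (2 * (L * C₀))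
      refine h.congr_deriv ?_
      have h1 := (hsq s hs).ne'
      rw [sq, hss s hs]
      have h2 : 1 - s ≠ 0 := by linarith
      field_simp
    have h := abs_sub_le_of_abs_deriv_le hr.1 (hqc le_rfl hr.2)
      (fun s hs => (hB s (hs.2.trans_lt hr.2)).continuousAt.continuousWithinAt)
      (fun s hs => hqd s (hsub le_rfl hr.2 (Ioo_subset_Icc_self hs)))
      (fun s hs => hB s (hs.2.trans hr.2)) fun s hs => by
        have hs' := hsub le_rfl hr.2 (Ioo_subset_Icc_self hs)
        have h1 : 0 < 1 - s := by linarith [hs'.2]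
        have h2 : |v s - b| ≤ C₀ := hC₀ s (Ioo_subset_Icc_self hs')
        refine (hqb s hs').trans ?_
        have h3 := hsq s hs'.2
        have h4 : (1 - s) * √(1 - s) ≤ 1 - s := mul_le_of_le_one_right h1.le (hs1 s hs')
        gcongr
    have hr' := hsub le_rfl hr.2 (right_mem_Icc.2 hr.1)
    have h1 := hsq r hr.2
    have h2 : 0 ≤ 2 * (L * C₀) * (√(1 - x₀))⁻¹ := by positivity
    have h3 : |q r| ≤ |q x₀| + |q r - q x₀| := by
      have := abs_add_le (q x₀) (q r - q x₀)
      rwa [add_sub_cancel] at this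
    have h4 : |q x₀| ≤ |q x₀| / √(1 - r) := le_div_self (abs_nonneg _) h1 (hs1 r hr')
    rw [hC₁, add_div]
    have : 2 * (L * C₀) * (√(1 - r))⁻¹ = 2 * (L * C₀) / √(1 - r) := rfl
    linarith
  have hC₁n : 0 ≤ C₁ := by positivity
  set C₂ : ℝ := 2 ^ n * C₁ with hC₂
  have hC₂n : 0 ≤ C₂ := by positivity
  have hv'grow : ∀ r ∈ Ico x₀ 1, |v' r| ≤ C₂ / √(1 - r) := fun r hr => by
    have hr0 : 1 / 2 ≤ r := by linarith [hr.1]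
    have h1 : v' r = (r ^ n)⁻¹ * q r := by
      simp only [hq]
      rw [inv_mul_cancel_left₀ (pow_ne_zero n (by linarith))]
    have h2 : |(r ^ n)⁻¹| ≤ 2 ^ n := by
      rw [← inv_pow, abs_pow]
      gcongr
      rw [abs_of_pos (by positivity)]
      exact inv_le_of_inv_le₀ (by norm_num) (by linarith)
    rw [h1, abs_mul, hC₂, mul_div_assoc]
    have := hqgrow r hr
    gcongr
  have hvb : ∀ r ∈ Ico x₀ 1, |v r - b| ≤ 2 * C₂ * √(1 - r) := fun r hr => by
    have h := abs_sub_le_of_abs_deriv_le (B := fun s => -2 * C₂ * √(1 - s))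
      (B' := fun s => C₂ / √(1 - s)) hr.2.le
      (hv.mono (Icc_subset_Icc_left (by linarith [hr.1]))) (by fun_prop)
      (fun s hs => hv' s ⟨by linarith [hr.1, hs.1], hs.2⟩)
      (fun s hs => by
        refine ((hsqrt s hs.2).const_mul (-2 * C₂)).congr_deriv ?_
        have := (hsq s hs.2).ne'
        field_simp)
      (fun s hs => hv'grow s ⟨hr.1.trans hs.1.le, hs.2⟩)
    rw [hv1, abs_sub_comm] at h
    simpa using h
  set B : ℝ → ℝ := fun s => -(4 * L * C₂) * √(1 - s) with hB
  have hqB : ∀ x y, x₀ ≤ x → x ≤ y → y < 1 → |q y - q x| ≤ B y - B x := fun x y hx hxy hy =>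
    abs_sub_le_of_abs_deriv_le (B' := fun s => 2 * L * C₂ / √(1 - s)) hxy (hqc hx hy)
      (by fun_prop) (fun s hs => hqd s (hsub hx hy (Ioo_subset_Icc_self hs)))
      (fun s hs => by
        refine ((hsqrt s (hs.2.trans hy)).const_mul (-(4 * L * C₂))).congr_deriv ?_
        have := (hsq s (hs.2.trans hy)).ne'
        field_simp
        ring)
      (fun s hs => by
        have hs1 : s < 1 := hs.2.trans hy
        refine (hqb s (hsub hx hy (Ioo_subset_Icc_self hs))).trans ?_
        have h1 := hvb s ⟨hx.trans hs.1.le, hs1⟩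
        have h2 := hsq s hs1
        calc L * |v s - b| / (1 - s) ≤ L * (2 * C₂ * √(1 - s)) / (1 - s) := by
              have : 0 ≤ 1 - s := by linarith
              gcongr
          _ = 2 * L * C₂ / √(1 - s) := by
              rw [div_eq_div_iff (by linarith) h2.ne']
              linear_combination 2 * L * C₂ * hss s hs1)
  have hmono : MonotoneOn (fun s => q s + B s) (Ioo x₀ 1) := fun x hx y hy hxy => by
    have := (abs_le.1 (hqB x y hx.1.le hxy hy.2)).1
    dsimp only
    linarith
  have hbdd : BddAbove ((fun s => q s + B s) '' Ioo x₀ 1) := by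
    refine ⟨q x₀ - B x₀, ?_⟩
    rintro _ ⟨y, hy, rfl⟩
    have := (abs_le.1 (hqB x₀ y le_rfl hy.1.le hy.2)).2
    have hBn : B y ≤ 0 := by
      simp only [hB]
      have : 0 ≤ 4 * L * C₂ * √(1 - y) := by positivity
      linarith
    dsimp only
    linarith
  have hlim := hmono.tendsto_nhdsWithin_Ioo_left (nonempty_Ioo.2 hx₀1) hbdd
  set l := sSup ((fun s => q s + B s) '' Ioo x₀ 1)
  have hBlim : Tendsto B (nhdsWithin 1 (Iio 1)) (nhds (B 1)) :=
    (by fun_prop : Continuous B).continuousAt.tendsto.mono_left nhdsWithin_le_nhds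
  have hplim : Tendsto (fun r : ℝ => (r ^ n)⁻¹) (nhdsWithin 1 (Iio 1)) (nhds ((1 ^ n)⁻¹)) :=
    (((continuous_pow n).continuousAt (x := (1 : ℝ))).inv₀ (by simp)).tendsto.mono_left
      nhdsWithin_le_nhds
  refine ⟨_, (hplim.mul (hlim.sub hBlim)).congr' ?_⟩
  filter_upwards [Ioo_mem_nhdsLT hx₀1] with r hr
  rw [add_sub_cancel_right]
  exact inv_mul_cancel_left₀ (pow_ne_zero n (by linarith [hr.1])) _

theorem hasDerivAt_deriv_of_contDiffOn_two {v : ℝ → ℝ} {s : Set ℝ} (hs : IsOpen s)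
    (hv : ContDiffOn ℝ 2 v s) {r : ℝ} (hr : r ∈ s) :
    HasDerivAt v (deriv v r) r ∧ HasDerivAt (deriv v) (deriv (deriv v) r) r := by
  rw [show (2 : WithTop ℕ∞) = 1 + 1 by norm_num, contDiffOn_succ_iff_deriv_of_isOpen hs] at hv
  have hmem := hs.mem_nhds hr
  exact ⟨(hv.1.differentiableAt hmem).hasDerivAt,
    ((hv.2.2.differentiableOn one_ne_zero).differentiableAt hmem).hasDerivAt⟩

theorem exists_eq_of_tendsto_deriv {n : ℕ} {a b τ : ℝ} {g v₁ v₂ : ℝ → ℝ} {K : NNReal}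
    (hg : LipschitzWith K g) (hτ : 0 < τ) (hτ' : τ ≤ 1 / 2)
    (hc₁ : ContinuousOn v₁ (Icc (1 - τ) 1)) (hc₂ : ContinuousOn v₂ (Icc (1 - τ) 1))
    (hv₁ : ContDiffOn ℝ 2 v₁ (Ioo (1 - τ) 1)) (hv₂ : ContDiffOn ℝ 2 v₂ (Ioo (1 - τ) 1))
    (hb₁ : v₁ 1 = b) (hb₂ : v₂ 1 = b)
    (ha₁ : Tendsto (deriv v₁) (nhdsWithin 1 (Iio 1)) (nhds a))
    (ha₂ : Tendsto (deriv v₂) (nhdsWithin 1 (Iio 1)) (nhds a))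
    (heq₁ : ∀ r ∈ Ioo (1 - τ) 1,
      (1 - r ^ 2) * deriv (deriv v₁) r + n * (1 / r - r) * deriv v₁ r + g (v₁ r) = 0)
    (heq₂ : ∀ r ∈ Ioo (1 - τ) 1,
      (1 - r ^ 2) * deriv (deriv v₂) r + n * (1 / r - r) * deriv v₂ r + g (v₂ r) = 0) :
    ∃ δ > 0, ∀ r ∈ Ioo (1 - δ) 1, v₁ r = v₂ r := by
  set δ : ℝ := min (τ / 2) (1 / (2 * (2 * n + K + 1))) with hδ
  have hδ0 : 0 < δ := by positivity
  have hδτ : δ ≤ τ / 2 := min_le_left _ _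
  have hsmall : (2 * n + K : ℝ) * δ < 1 := by
    have h1 : (0 : ℝ) < 2 * (2 * n + K + 1) := by positivity
    have h2 : δ * (2 * (2 * n + K + 1)) ≤ 1 := by
      rw [← le_div_iff₀ h1]; exact min_le_right _ _
    have : (0 : ℝ) ≤ 2 * n + K := by positivity
    nlinarith
  have hsub : Icc (1 - δ) 1 ⊆ Icc (1 - τ) 1 := Icc_subset_Icc_left (by linarith)
  have hsub' : ∀ r ∈ Ico (1 - δ) 1, r ∈ Ioo (1 - τ) 1 := fun r hr => ⟨by linarith [hr.1], hr.2⟩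
  have hd₁ := fun r hr => hasDerivAt_deriv_of_contDiffOn_two isOpen_Ioo hv₁ (hsub' r hr)
  have hd₂ := fun r hr => hasDerivAt_deriv_of_contDiffOn_two isOpen_Ioo hv₂ (hsub' r hr)
  have hne : ∀ {r : ℝ}, r < 1 → Function.update (fun r => deriv v₁ r - deriv v₂ r) 1 0
      =ᶠ[nhds r] fun r => deriv v₁ r - deriv v₂ r := fun hr => by
    filter_upwards [Iio_mem_nhds hr] with s hs
    exact Function.update_of_ne hs.ne _ _
  refine ⟨δ, hδ0, fun r hr => sub_eq_zero.1 ?_⟩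
  refine eq_zero_of_abs_deriv_le (d := fun r => v₁ r - v₂ r)
    (D := Function.update (fun r => deriv v₁ r - deriv v₂ r) 1 0)
    (E := fun r => deriv (deriv v₁) r - deriv (deriv v₂) r)
    (by positivity : (0 : ℝ) ≤ 2 * n) K.coe_nonneg hδ0 hsmall
    ((hc₁.mono hsub).sub (hc₂.mono hsub)) ?_ ?_ ?_ (by simp [hb₁, hb₂]) (by simp) ?_ r
    (Ioo_subset_Icc_self hr)
  · intro s hs
    rcases hs.2.eq_or_lt with rfl | h1
    · rw [continuousWithinAt_update_same]
      have := (ha₁.sub ha₂).mono_left (nhdsWithin_mono 1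
        (fun x hx => lt_of_le_of_ne hx.1.2 hx.2 : Icc (1 - δ) 1 \ {1} ⊆ Iio (1 : ℝ)))
      simpa using this
    · have h2 : s ∈ Ico (1 - δ) 1 := ⟨hs.1, h1⟩
      exact (((hd₁ s h2).2.sub (hd₂ s h2).2).continuousAt.congr
        (hne h1).symm).continuousWithinAt
  · intro s hs
    have h2 := Ioo_subset_Ico_self hs
    rw [Function.update_of_ne hs.2.ne]
    exact (hd₁ s h2).1.sub (hd₂ s h2).1
  · intro s hs
    have h2 := Ioo_subset_Ico_self hs
    exact ((hd₁ s h2).2.sub (hd₂ s h2).2).congr_of_eventuallyEq (hne hs.2)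
  · intro s hs
    have h2 := hsub' s (Ioo_subset_Ico_self hs)
    rw [Function.update_of_ne hs.2.ne]
    have h3 : 1 / 2 < s := by linarith [h2.1]
    have h4 : 0 < 1 - s := by linarith [hs.2]
    have h5 : 1 - s ≤ 1 - s ^ 2 := by nlinarith
    have h6 : (1 - s ^ 2) ≠ 0 := by linarith
    have h7 : s ≠ 0 := by linarith
    have hE : deriv (deriv v₁) s - deriv (deriv v₂) s =
        -(n / s * (deriv v₁ s - deriv v₂ s)) + -((g (v₁ s) - g (v₂ s)) / (1 - s ^ 2)) := by
      have e₁ := heq₁ s h2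
      have e₂ := heq₂ s h2
      field_simp at e₁ e₂ ⊢
      linear_combination e₁ - e₂
    have h8 : |g (v₁ s) - g (v₂ s)| ≤ K * |v₁ s - v₂ s| := hg.dist_le_mul _ _
    have h9 : (n : ℝ) / s ≤ 2 * n := by
      rw [div_le_iff₀ (by linarith)]
      nlinarith [(Nat.cast_nonneg n : (0 : ℝ) ≤ n)]
    rw [hE]
    refine (abs_add_le _ _).trans ?_
    rw [abs_neg, abs_neg, abs_mul, abs_div _ (1 - s ^ 2), abs_of_pos (by linarith : 0 < 1 - s ^ 2),
      abs_of_nonneg (by positivity : 0 ≤ (n : ℝ) / s), ← mul_div_assoc]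
    gcongr

theorem stmt14 (N : ℕ) (p : ℝ) (hN : 4 ≤ N) (hp : p = 1 + 4 / ((N : ℝ) - 3))
    (u : ℝ → ℝ → ℝ)
    (hu : ∀ c : ℝ,
      ContDiffOn ℝ 2 (u c) (Ico 0 1) ∧
      IsSolOn N p (u c) (Ioo 0 1) ∧
      u c 0 = c ∧
      derivWithin (u c) (Ici 0) 0 = 0 ∧
      ContinuousOn (u c) (Icc 0 1))
    (c : ℝ) (hc : u c 1 = b0 p) :
    ∃ a : ℝ,
      Tendsto (deriv (u c)) (nhdsWithin 1 (Iio 1)) (nhds a) ∧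
      -- `u(·,c)` coincides near `ρ = 1` with the solution `U(·,a)`
      (∀ (U : ℝ → ℝ) (ε : ℝ), 0 < ε →
        ContDiffOn ℝ 2 U (Ioo 0 (1 + ε)) →
        IsSolOn N p U (Ioo 0 (1 + ε)) →
        U 1 = b0 p → deriv U 1 = a →
        ∃ δ > 0, ∀ ρ ∈ Ioo (1 - δ) 1, u c ρ = U ρ) ∧
      -- in particular `u(·,c)` extends to a `C²` solution near `ρ = 1`
      (∃ (W : ℝ → ℝ) (ε : ℝ), 0 < ε ∧
        ContDiffOn ℝ 2 W (Ioo (1 - ε) (1 + ε)) ∧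
        IsSolOn N p W (Ioo (1 - ε) (1 + ε)) ∧
        EqOn W (u c) (Ioo (1 - ε) 1)) := by
  obtain ⟨hu2, hsol, -, -, hucont⟩ := hu c
  have hN' : (4 : ℝ) ≤ N := by exact_mod_cast hN
  have hN3 : (0 : ℝ) < N - 3 := by linarith
  have hp1 : p - 1 = 4 / ((N : ℝ) - 3) := by rw [hp]; ring
  have hp0 : 0 < p - 1 := by rw [hp1]; positivity
  have hα : alphaP p = ((N : ℝ) - 3) / 2 := by
    rw [alphaP, hp1]; field_simp; norm_num
  obtain ⟨n, rfl⟩ : ∃ n, N = n + 1 := ⟨N - 1, by omega⟩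
  have hcoef : ∀ ρ : ℝ, (((n + 1 : ℕ) : ℝ) - 1) / ρ - 2 * (alphaP p + 1) * ρ
      = n * (1 / ρ - ρ) := fun ρ => by
    rw [hα]; push_cast; ring
  set b := b0 p with hb
  have hbase : 0 < 2 * (p + 1) / (p - 1) ^ 2 := by
    have : 0 < p + 1 := by linarith
    positivity
  have hbpos : 0 < b := Real.rpow_pos_of_pos hbase _
  have hbpow : b ^ (p - 1) = alphaP p * (alphaP p + 1) := by
    rw [hb, b0, ← Real.rpow_mul hbase.le, one_div, inv_mul_cancel₀ hp0.ne', Real.rpow_one, alphaP]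
    field_simp
    ring
  set f : ℝ → ℝ := fun x => |x| ^ (p - 1) * x - alphaP p * (alphaP p + 1) * x with hf
  have hfb : f b = 0 := by
    simp only [hf]
    rw [abs_of_pos hbpos, hbpow, sub_self]
  have hfd : ContDiffAt ℝ 1 f b := by
    have h1 : ContDiffAt ℝ 1 (fun x : ℝ => |x| ^ (p - 1)) b :=
      (contDiffAt_abs hbpos.ne').rpow_const_of_ne (abs_pos.2 hbpos.ne').ne'
    exact (h1.mul contDiffAt_id).sub (contDiffAt_const.mul contDiffAt_id)
  obtain ⟨K, t, ht, hK⟩ := hfd.exists_lipschitzOnWith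
  obtain ⟨g, hg, hfg⟩ := hK.extend_real
  have hgb : g b = 0 := (hfg (mem_of_mem_nhds ht)).symm.trans hfb
  have hgd : DifferentiableAt ℝ g b :=
    (hfd.differentiableAt one_ne_zero).congr_of_eventuallyEq
      (by filter_upwards [ht] with x hx using (hfg hx).symm)
  -- Near `1` the profile equation has the nonlinearity `g`.
  have hiff : ∀ (v : ℝ → ℝ) (ρ : ℝ), v ρ ∈ t → (IsSolOn (n + 1) p v {ρ} ↔
      (1 - ρ ^ 2) * deriv (deriv v) ρ + n * (1 / ρ - ρ) * deriv v ρ + g (v ρ) = 0) :=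
    fun v ρ hv => by
      rw [← hfg hv]
      simp only [IsSolOn, mem_singleton_iff, forall_eq, hcoef, hf]
      rw [add_sub, sub_add_eq_add_sub]
  have hloc : ∀ v : ℝ → ℝ, v 1 = b → ContinuousWithinAt v (Iio 1) 1 →
      ∀ᶠ r in nhdsWithin 1 (Iio 1), v r ∈ t := fun v hv hvc => hvc (by rwa [hv])
  have hred : ∀ (v : ℝ → ℝ), v 1 = b → ContinuousWithinAt v (Iio 1) 1 →
      IsSolOn (n + 1) p v (Ioo 0 1) → ∀ᶠ r in nhdsWithin 1 (Iio 1),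
      (1 - r ^ 2) * deriv (deriv v) r + n * (1 / r - r) * deriv v r + g (v r) = 0 :=
    fun v hv hvc hvs => by
      filter_upwards [hloc v hv hvc, Ioo_mem_nhdsLT (zero_lt_one (α := ℝ))] with r hr hr'
      exact (hiff v r hr).1 (by rintro _ rfl; exact hvs _ hr')
  have hex : ∀ {P : ℝ → Prop}, (∀ᶠ r in nhdsWithin 1 (Iio 1), P r) →
      ∃ τ > 0, τ ≤ 1 / 2 ∧ ∀ r ∈ Ioo (1 - τ) 1, P r := fun {P} hP => by
    obtain ⟨l, hl, hP⟩ := mem_nhdsLT_iff_exists_Ioo_subset.1 hP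
    rw [mem_Iio] at hl
    refine ⟨min (1 - l) (1 / 2), by positivity, min_le_right _ _, fun r hr => hP ⟨?_, hr.2⟩⟩
    linarith [hr.1, min_le_left (1 - l) (1 / 2)]
  have hucw : ContinuousWithinAt (u c) (Iio 1) 1 :=
    ((hucont 1 (by simp)).mono Ico_subset_Icc_self).mono_of_mem_nhdsWithin
      (Ico_mem_nhdsLT zero_lt_one)
  have hueq := hred _ hc hucw hsol
  have hu2' : ContDiffOn ℝ 2 (u c) (Ioo 0 1) := hu2.mono Ioo_subset_Ico_self
  obtain ⟨a, ha⟩ : ∃ a, Tendsto (deriv (u c)) (nhdsWithin 1 (Iio 1)) (nhds a) := by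
    obtain ⟨τ, hτ, hτ', h⟩ := hex hueq
    have hsub : Ioo (1 - τ) 1 ⊆ Ioo 0 1 := Ioo_subset_Ioo_left (by linarith)
    exact exists_tendsto_deriv (f := fun r => g (u c r)) hτ hτ' K.coe_nonneg
      (hucont.mono (Icc_subset_Icc_left (by linarith))) hc
      (fun r hr => (hasDerivAt_deriv_of_contDiffOn_two isOpen_Ioo hu2' (hsub hr)).1)
      (fun r hr => (hasDerivAt_deriv_of_contDiffOn_two isOpen_Ioo hu2' (hsub hr)).2)
      (fun r _ => by simpa [hgb, Real.dist_eq] using hg.dist_le_mul (u c r) b) h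
  have huniq : ∀ (V : ℝ → ℝ) (s : Set ℝ), IsOpen s → 1 ∈ s → ContDiffOn ℝ 2 V s → V 1 = b →
      deriv V 1 = a → (∀ᶠ r in nhdsWithin 1 (Iio 1),
        (1 - r ^ 2) * deriv (deriv V) r + n * (1 / r - r) * deriv V r + g (V r) = 0) →
      ∃ δ > 0, ∀ ρ ∈ Ioo (1 - δ) 1, u c ρ = V ρ := by
    intro V s hs h1s hV hV1 hVa hVeq
    have hsn : ∀ᶠ r in nhdsWithin 1 (Iio 1), r ∈ s := nhdsWithin_le_nhds (hs.mem_nhds h1s)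
    obtain ⟨τ, hτ, hτ', h⟩ := hex (hueq.and (hVeq.and hsn))
    have hsub : Ioo (1 - τ) 1 ⊆ s := fun r hr => (h r hr).2.2
    have hda : Tendsto (deriv V) (nhdsWithin 1 (Iio 1)) (nhds a) := by
      have := (hasDerivAt_deriv_of_contDiffOn_two hs hV h1s).2.continuousAt.tendsto
      rw [hVa] at this
      exact this.mono_left nhdsWithin_le_nhds
    have hsub' : Icc (1 - τ / 2) 1 ⊆ s := fun r hr => by
      rcases hr.2.eq_or_lt with rfl | hr1
      · exact h1s
      · exact hsub ⟨by linarith [hr.1], hr1⟩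
    have hmono : Ioo (1 - τ / 2) 1 ⊆ Ioo (1 - τ) 1 := Ioo_subset_Ioo_left (by linarith)
    exact exists_eq_of_tendsto_deriv hg (half_pos hτ) (by linarith)
      (hucont.mono (Icc_subset_Icc_left (by linarith))) (hV.continuousOn.mono hsub')
      (hu2'.mono (Ioo_subset_Ioo_left (by linarith))) (hV.mono (hmono.trans hsub)) hc hV1 ha hda
      (fun r hr => (h r (hmono hr)).1) (fun r hr => (h r (hmono hr)).2.1)
  refine ⟨a, ha, fun U ε hε hU hUs hU1 hUa => ?_, ?_⟩
  · have h1 : (1 : ℝ) ∈ Ioo 0 (1 + ε) := ⟨one_pos, by linarith⟩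
    exact huniq U _ isOpen_Ioo h1 hU hU1 hUa (hred U hU1
      (hU.continuousOn.continuousAt (isOpen_Ioo.mem_nhds h1)).continuousWithinAt
      fun ρ hρ => hUs ρ ⟨hρ.1, by linarith [hρ.2]⟩)
  · obtain ⟨W, ε, hε, hε', hW, hW1, hWa, hWeq⟩ := exists_contDiffOn_solution n a b hg hgb hgd
    have h1 : (1 : ℝ) ∈ Ioo (1 - ε) (1 + ε) := ⟨by linarith, by linarith⟩
    obtain ⟨δ, hδ, huW⟩ := huniq W _ isOpen_Ioo h1 hW hW1 hWa (by
      filter_upwards [Ioo_mem_nhdsLT (show 1 - ε < 1 by linarith)] with r hr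
      exact hWeq r ⟨hr.1, by linarith [hr.2]⟩)
    have hWt : ∀ᶠ r in nhds 1, W r ∈ t :=
      hW.continuousOn.continuousAt (isOpen_Ioo.mem_nhds h1) (by rwa [hW1])
    obtain ⟨η, hη, hηt⟩ := Metric.eventually_nhds_iff_ball.1 hWt
    rw [Real.ball_eq_Ioo] at hηt
    set ε' := min ε (min δ η) with hε'
    have e₁ : ε' ≤ ε := min_le_left _ _
    have e₂ : ε' ≤ δ := (min_le_right _ _).trans (min_le_left _ _)
    have e₃ : ε' ≤ η := (min_le_right _ _).trans (min_le_right _ _)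
    refine ⟨W, ε', by positivity, hW.mono (Ioo_subset_Ioo (by linarith) (by linarith)),
      fun ρ hρ => ?_, fun ρ hρ => (huW ρ ⟨by linarith [hρ.1], hρ.2⟩).symm⟩
    exact (hiff W ρ (hηt ρ ⟨by linarith [hρ.1], by linarith [hρ.2]⟩)).2
      (hWeq ρ ⟨by linarith [hρ.1], by linarith [hρ.2]⟩) ρ rfl
end
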